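/- Let f : [0,1) → [0,1) be the Lanford map, f(x) = 2x + (1/2)x(1−x) mod 1, so that f'(y) = 5/2 − y. Suppose ρ : [0,1] → ℝ is a nonnegative function of bounded variation with ∫₀¹ ρ(x) dx = 1 satisfying the transfer equation ρ(x) = Σ_{y ∈ [0,1), f(y) = x} ρ(y)/(5/2 − y) for Lebesgue-almost every x ∈ [0,1). Then the Lyapunov exponent L_exp = ∫₀¹ log(5/2 − x) · ρ(x) dx satisfies |L_exp − 0.65766178000659767754158241382383206574324106958001220195395280269163266611155402375955645975291517482964215633179802630148859489| ≤ 2 × 10^{−128}. -/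

import Mathlib

/-- The Lanford map `f(x) = 2x + (1/2)x(1-x) mod 1` on `[0,1)`. -/
noncomputable def lanford (x : ℝ) : ℝ := Int.fract (2 * x + (1 / 2) * x * (1 - x))

/-- Taylor coefficients in `2 * x - 1`, scaled by `10 ^ 148`, of the part of the approximate
distribution function that comes from the left branch of the Lanford map. -/
def leftCoeffs : List ℤ :=
  [0,
   1820478453253674787228480331472214001225272114510423489452604126590562166387587493294543561676174296579402566409388119853341669911327099809222409690,
   182047845325367478722848033147221400122527211451042348945260412659056216638758749329454356167617429657940256640938811985334166991132709980922240969,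
   24273046043382330496379737752962853349670294860138979859368055021207495551834499910593914155682323954392034218791841598044555598817694664122965463,
   3640956906507349574456960662944428002450544229020846978905208253181124332775174986589087123352348593158805132818776239706683339822654199618444819,
   582553105041175931913113706071108480392087076643335516624833320508979893244027997854253939736375774905408821251004198353069334371624671938951171,
   97092184173529321985518951011851413398681179440555919437472220084829982207337999642375656622729295817568136875167366392178222395270778656491862,
   16644374429747883768946105887745956582631059332666729046423809157399425521257942795835826849610736425868823464314405667230552410617847769684319,
   2912765525205879659565568530355542401960435383216677583124166602544899466220139989271269698681878874527044106255020991765346671858123359694756,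
   517824982258823050589434405396540871459632957016298236999851840452426571772469331426003501987889577693696730000892620758283852774777486167957,
   93208496806588149106098192971377356862733932262933682659973331281436782919044479656680630357820123984865411400160671736491093499459947510232,
   16946999419379663473836035085704973975042533138715215029086060232988505985280814483032841883240022542702802072756485770271107908992717729133,
   3106949893552938303536606432379245228757797742097789421999111042714559430634815988556021011927337466162180380005355724549703116648664917008,
   573590749579003994499065802900783734539901121618053431753682038654995587194119874810342340663508455291479454770219518378406729227445830832,
   106523996350386456121255077681574122128838779729067065897112378607356323336050833893349291837508713125560470171612196270275535427954225726,
   19884479318738805142634281167227169464049905549425852300794310673373180356062822326758534476334959783437954432034276637118099946551455469,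
   3728339872263525964243927718855094274509357290517347306398933251257471316761779186267225214312804959394616456006426869459643739978397900,
   701805152426075475622386394137429510495879019391500669439799200236700483155158435062065922694175051180163097601209763662991762819463134,
   132563195458258700950895207781514463093666036996172348671962071155821202373752148845056896508899731889586362880228510914120666310343036,
   25117237034196385443327513053339582480905143851906339748371760850576648870816196623273938285896791305395310861516981015307073616696575,
   4772275036497313234232227480134520671371977331862204552190634561609563285455077358422048274320390348025109063688226392908343987172349,
   909004768856631092234709996216099175499424253688038962322025630782773959134300449223247290346741018671449345464424074839684568985209,
   173537274054447753972080999277618933504435539340443801897841256785802301289275540306256300884377830837276693225026414287576144988085,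
   33198435036503048585963321600935795974761581439041422971760936080762179377078799015109901038750541551479019573483314037623262519460,
   6363033381996417645642969973512694228495969775816272736254179415479417713940103144562731032427187130700145418250968523877791982896,
   1221702409343312187963450234914437291871226196956724365360802447772048201076499803756044358226019929094427920304185956584536060716,
   234942771027560036146817352868161017667543499414754685646308163033086192514711500722316222735773063287389984673881914727795396292,
   45248237383085636591238897589423603402638007294693495013363053621186970410240733472446087341704441818312145196451331725353187434,
   8726445781023658485453215963674552084794472835405174038291446055514630007689284312543173987328713779245913716458471118460971862,
   1685106771508016810984069289537154885339622340629964641876968893478687173898620418973854287208303350475072993523015112530394567,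
   325787309158216583456920062643849944498993652521793164096213986072546186953733281001611828860271981091847445414449588422542950,
   63055608224170951636823237931067731193353610165508354341202706981783132958787086645473257198762318921002731370538630017266377,
   12217024093433121879634502349144372918712261969567243653608024477720482010764998037560443582260199290944279203041859565845361,
   2369362248423393334232145910137090505447226563794859375245192625982154086936242043648086028074705317031617784832360643073040,
   459935024693952823703887147261905803998579274148413878724066803867124028640564632002275523096854561541431687643928830714178,
   89358804797682262891040931468027413348295401834548982152104407608469811278738271360442101630246029099478156456534744253040,
   17375323155104884451035736674338663706612994801162302085131412590535796637532441653419297539214505658231863755437311382536,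
   3381143965317707244525873082574010234800366555901853378728274882482641507844150808232944386009309209169443757814828160926,
   658433298509237726565564758185465150987439802991413552699716687641356504159124104761152327801812845996154837048150747128,
   128310078683851454407648516979731670448834423147044692320970431437802805938701107594480966443430195630019916963229376363,
   25020465343351033609491460811047675737522712513673715002589234130371547158046715980923788456468888147853883807829728391,
   4882042018214835826242236255814180631711748783155846829773509098609082372301798240180251406140270858117830986893605540,
   953160584508610804171103268992292409048484286235189142955780347823677986973208227844715750722624310394433668869703939,
   186198811857496064070634126965936191535052744287804390716943137714392909083138351485944472234187074588680065546639839,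
   36393404135783321613805761179705710163669400019889040003766158735085886775340677790434601391227473669605649175025059,
   7116932364330960671144237741809116654228682670556078934069826597083462302733288101240544272062261517611771394227123,
   1392443288673448826963003036440914128001264000760971965361487812472851320099991150242715183664355514315346577131394,
   272563367144589983150204849686306595268332527808530682581397614356387917977019544302829355100256824078748691693805,
   53376992732482205033581783063568374906715120029170592005523699478125967270499660759304082040466961382088285456703,
   10457533270037329965762961579801151002131941883266075168429132958979781342791770271210595665071078148327500824170,
   2049676520927316673289540469641025596417860609120150733012110059960037143187186973157276750353931317072190161537,
   401897357044571896723439307772750116944678550807872692747472560776477871213173916305348382422339473935723561086,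
   78833712343358333588059248832347138323763869581544258962004233075386043968737960506049105782843512195084236982,
   15469256761715597534260682789743589406927249880152081003864981584604053910846694137036050946067406166582567257,
   3036557808781209886354874769838556439137571272770593678536459348088943915832869589862632222746564914181022462,
   596269533360673941320593591168298355321559449925862031421704744715647168927181664918480509193870928602818956,
   117124372624418095616545169693772891223877749092580041886406289140573551039267827037558671448796075261268009,
   23013911813920748612373787729302743538726855962050815247855270848674101256838590575801002109237123560108802,
   4523424046184423003121744484725022005887692378747918859061208408187668178068274699381576276643158768711040,
   889351168402361132817156542759495852005037823618234894323898602287744929925287906997055674729841385034713,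
   174905729785797689454040786742700850894324105311586195883700058449923169551973288376087616030202139056827,
   34407684548025774974565400670695249356260479733426792632859027891788164502027532139558219546925010961999,
   6770544378805071849833836906169065195909320205609788227756131294835735595560256324235649652782018286071,
   1332615084082268110126025041849149340147231278564466254352000445332747958491225054294000884039635345195,
   262358594678696534181061180114051276341486157967379293825550087674884754327959932564131424045303208585,
   51664461721343317500270509314767020571861889568960845553339094188284997775352109797244341965844324152,
   10176333369355501931871463955938958597487947945401378669597094309813711683023900414608734023575397181,
   2004889559335710828368706331617824678908073326556689528935546938649865585312171424967690882256645415,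
   395081177869095957355009777112924274961296802586171171878475426145708806517398486684809673856456596,
   77871072739416014783016419836750291876429514712636636776047330370748402444008977085701616876055213,
   15351725768627728628651808482102200398496104329062651250135045130233256481818912625466890184136599,
   3027100855785749307058103080977898670125992402913762218336487772158670292189644743049809332083273,
   597011557668856113336459218748418904385959612796880881949696199509071085404068824323712396049757,
   117766663430568877151301544520236057851476964716097050685967469492200323696145083154266554837212,
   23235044406571697383905439864803330332858968714256985675880068305217901702212408298003941900315,
   4585048762896814950424006799987857185684169826280045173373666812229665935903248570806111201662,
   904943834782266108636317131576550760332401939397377336850065818203223539980904323185416684539,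
   178638263489486296769766498700825604637045577647274487274298706969986984515710983278160176688,
   35269605868437038080184667692214286043724383279077270564412821632535891814640373621585470782,
   6964631032248326506973174886057504585849371888020321782339747056551391295042909221477637268,
   1375514628869044485127202039996357155705250947884013552012100043668899780770974571241833360,
   271706593356848293358459662221502648040543397112891565829550625909906129535007322714436219,
   53678619663182223809842030829126132905570768697912723980960001704152186566672178389925204,
   10606377861158897234715774766236970839173019357177935822743903951181877827631611151744257,
   2096022291609972548765260251423020427741334777728020650685104828447847284984342203797079,
   414272641165265162579486732045961684541816756068597022723644248446162757502787635574011,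
   81891103486157067021526447032341263223382382013559876584906421204474033459853369822770,
   16189965286918408652531665390301950890139965179692297439774602812838544546085953574157,
   3201197681731594438114215656718794835095856751439158811955432828902166762521540820345,
   633045833690742270907979725373604371884124481183474102139501323468293651914372117282,
   125202398218835693579578212351668420217082397389620433534256928419284744489731374307,
   24765309537791675653103382662967379823159155527617228611171700126891487921045766346,
   4899224278128353227026973526804416443277137289159060442644836329450272610467749429,
   969308889436147305132218418206465188777412108822867872523279445826720602501146124,
   191799418548003615696375133815321835226168778979844068392904230769968119218311893,
   37956095460025978685177394902400531602652347840221773534595784615530533066360669,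
   7512143893130141614774692741100105213024943843377226012055415705157084669383882,
   1486939822145347618594578357001257939072978575183945767334680222051711604661552,
   294353393363466773476885919651269428755263105699679060064212207222481685004430,
   58276025352767159193403677021867482864678352239532419972308679409703444707948,
   11538653019847897520293928050329761607206313743427419154517118523121282052174,
   2284881786108494558474045158481140912318081929391568149409330400618075653896,
   452496196856780294913487374522735749302208382095192908020279157769462041262,
   89620605979401145788690703303532128988010203832445974015666939985408015939,
   17751773876689073108144504692815017857240482682196029468487874650955818542,
   3516541872715549720470530453433832108862876569425499170900455168951247864,
   696673389877608906885671127567079946095475546772976250838769420263926464,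
   138032484723414101177347924340393409880598893379318659044690763641077019,
   27350881232232053381437459082263138624489039984420549107003540202954150,
   5419991143268003238890358864008108204485901501499851933130976774163391,
   1074143699302204278252816574867061444161751388479061564929593578879654,
   212893345807644091185242924748426592536563338257111301157216745363535,
   42198502472586596645646365441205985306354518833105990050805462027415,
   8365012879521590839490960937017823635949922317359063514495949994815,
   1658327114712175026074523834882480826074282845371182766908846227042,
   328781375786413831256514290741917937691249120647504061613232121535,
   65189410716271707921550247302276832473264911852522357044002920649,
   12926447253141056613503980661648055669912358589559988747186903924,
   2563380217995768853864348707479360192169060940641557090543843659,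
   508367841552102058413433861315234458278906203354123927200291684,
   100826288574500241585331049160854834225316396998567912228057851,
   19998602692462857835106984957524925796756971305501073499780070,
   3966935943914763603357287180099206592471464799943655563071129,
   786936886435123836763559408084720657368323098525408095438500,
   156118124244387470841802914829710711058554421159072896353122,
   30973835850086474215013698302214605074017197157960062636459,
   6145602351207633772820178234566389895638332769436520364377,
   1219442356302617095079279460717110435984929021966931599861,
   241983092578800579804794517986051602140759352796562989347,
   48021450930366626689943718298007139649639065361178391684,
   9530411030795838220004214862219878484312983740910788504,
   1891531960310624379542821270364250691543034940944125963,
   375440434546502717757741797602601273624450874641940153,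
   74523514827275727434619424486531380629214308951482857,
   14793473838847271266872214114490557647291795657533164,
   2936778510230421258905002505691458851462371286088065,
   583036910119274808753199026865216095510911946502778,
   115756233249958210205014697304626845240122663831208,
   22983483993107644634908715261933156228835949195472,
   4563627037480366848370363605966583538963109336655,
   906205940299672845604972201756221588451245996850,
   179955789563055600545668238646625563664077219233,
   35737699054071605178787636125597471093851954805,
   7097557014934500608934048013755022231226542073, 1409653684910602204274401202731900248701938217,
   279986387071898920573122445783991221811143591, 55613734418390881483702403614628393373446330,
   11047081938891249927374899221409177459215189, 2194487898671640188275824575063714981763017,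
   435951958393829191764861794777758144028089, 86609122400907399430619209895847951280247,
   17207110410776304522639578125002904227864, 3418781147404239451208653022204524392641,
   679287234516920779847993803104689813963, 134975255689725817294471495941581222774,
   26820889517700355952707884354843236525, 5329792147748147657268874455129104694,
   1059168885412370744629228554140306156, 210493056974357223932644155696238059,
   41833840254023196706110410817617124, 8314475750487110345339444150001403,
   1652566608792469136961877098136925, 328473116068626581544274336790179,
   65291588715481602711868027680993, 12978693854418903953700595746344,
   2580007020757212422311391154425, 512892961957759096001662096964,
   101964349323338934055420249217, 20271483734520954746732359070, 4030306825324876210001226419,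
   801319827623416564106126194, 159326749352024346079580647, 31680086208367631604195687,
   6299392864554026168695559, 1252637891457294858832565, 249095992129793491927847,
   49536134798538478508379, 9851253926037030754209, 1959181960571409487073, 389647361990738423127,
   77496530884824641933, 15413674651125343147, 3065796826212842978, 609808767618292264,
   121298917906682048, 24128649616031889, 4799785138673010, 954823567693241, 189948943785783,
   37788784583838, 7517979248785, 1495723620177, 297586678598, 59208955742, 11780750988,
   2344067376] ++ List.replicate 114 0

/-- The counterpart of `leftCoeffs` for the right branch. -/
def rightCoeffs : List ℤ :=
  [0,
   3034130755422791312047467219120356668708786857517372482421006877650936943979312488824239269460290494299004277348980199755569449852211833015467320274,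
   505688459237131885341244536520059444784797809586228747070167812941822823996552081470706544910048415716500712891496699959261574975368638835895113803,
   112375213163807085631387674782235432174399513241384166015592847320405071999233795882379232202232981270333491753665933324280349994526364185754469734,
   28093803290951771407846918695558858043599878310346041503898211830101267999808448970594808050558245317583372938416483331070087498631591046438617433,
   7491680877587139042092511652149028811626634216092277734372856488027004799948919725491948813482198751355566116911062221618689999635090945716964649,
   2081022465996427511692364347819174669896287282247854926214682357785279111096922145969985781522832986487657254697517283782969444343080818254712402,
   594577847427550717626389813662621334256082080642244264632766387938651174599120613134281651863666567567902072770719223937991269812308805215632115,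
   173418538833035625974363695651597889158023940187321243851223529815439925924743512164165481793569415540638104558126440315247453695256734854559367,
   51383270765343889177589243156029004194970056351798887067029194019389607681405485085678661272168715715744623572778204537851097391187180697647220,
   15414981229603166753276772946808701258491016905539666120108758205816882304421645525703598381650614714723387071833461361355329217356154209294166,
   4671206433213080834326294832366273108633641486527171551548108547217237061945953189607151024742610519613147597525291321622827035562470972513384,
   1427313076815108032710812309889694560971390454216635751861922056094155768927930141268851702004686547659572877021616792718086038644088352712423,
   439173254404648625449480710735290634145043216682041769803668324952047928900901581928877446770672783895253192929728243913257242659719493142284,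
   135934578744296003115315458084732815330608614687298643034468767247062454183612394406557304952827290253292654954439694544579622728008414544040,
   42290757831558756524764809181916875880633791236048466721834727587974985746012744926484494874212934745468825985825682747202549293158173413701,
   13215861822362111413989002869349023712698059761265145850573352371242183045628982789526404648191542107959008120570525858500796654111929191782,
   4146152728584191816153412664893811360846450121181222227630855645879900563334582835929852438648326935830277057433890465412014636584134648402,
   1305270303443171497677926209318422095081289852964458849439343444073302029197924226126064656611510331650272406969928479851930533739449796719,
   412190622139948894003555645047922766867775743041408057717687403391569061851976071408230944193108525784296549569451098900609642233510462122,
   130527030344317149767792620931842209508128985296445884943934344407330202919792422612606465661151033165027240696992847985193053373944979672,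
   41437152490259412624696070137092764923215550887760598394899791875342921561838864321462370051159058147627695459362808884188270912363485610,
   13184548519627994926039658679984061566477675282469281307468115596700020496948729556828935925368791228790630373433621008605358926661109058,
   4203769093214723019896702767531150064674041394410495489337660045324644216418435510872994063161063870049186495877386408540839078065860859,
   1342870682554703186911446717405784048437541000992241614649530292256483569133666899306650881287562069599045686183053991617212483271038886,
   429718618417505019811662949569850895500013120317517316687849693522074742122773407778128282012019862271694619578577277317507994646732443,
   137730326415866993529379150503157338301286256512024780989695414590408571193196605057092398080775596881953403711082460678688459822670655,
   44209734405093109034121702630643096244857316905094374144840503448773121617569280635609905556792166900380104894915357748714814264067124,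
   14210271773065642189539118702706709507275566148066048832270161822819931948504411632874612500397482217979319430508507847801190299164433,
   4573420800526873348357417513514803059812825886733900773604190011942047063886477307132059195530224162108286713267105974004980785937978,
   1473657813503103634470723421021436541495243896836479138161350114959104053918976021186996851893072230012670163163845258290493808802237,
   475373488226807624022814006781108561772659321560154560697209714502936791586766458447418339320345880649248439730272663964675422194270,
   153506022239906628590700356356399639739087905920466576891807303641573338949893335540312172072195023959653141996233881071926438416900,
   49618108198757698130327387913179681531826393832878085459978118348791382286834209467575651578891320875847480241206911053551980094351,
   16052917358421608218635331383675779319120303887107615884110567701079564857505185415980357863758956753950655372155177105560934736408,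
   5198087525584139804129535876618823779524669830111037524378660017492430525287393372793639689217185996517355072888343062753064581313,
   1684565401809674936523460700756100298920031889387836234752343524187361744306099704146086936320384350723216921769370437003307966166,
   546345535722056736169771038083059556406496828990649589649408710547252457612789093236568736103908438072394677330606628217289070108,
   177322673874702624897206389553273715675792830461877498394983528861827552032221021489061782770566773760338623344144256526663996439,
   57591979549048715778579853017302574322052372286763631957345077749995273309610246295592715771637071819597159718610955111224203971,
   18717393353440832628038452230623336654667020993198180386137150268748463825623330046067632625782048341369076908548560411147866291,
   6086957188110839879036895034349052570623421461202660288174683014227142707519782128802482154725869379307016880828800133706623184,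
   1980676545337654246353275368319929804726668888169119617580650822089784531811992597467474351934608290091965810428419091126758338,
   644871433365747894161531515266953889911008475217852898747188639750162405706230148012666068071732931657849333627857378506386436,
   210071754808539086734438296639992555046767912381573292773705390221643813980059820943520007023367545918844858681802024816474369,
   68467831196857183824557667053034610533761393665105369496615090146313539371278756455665780066875348299475361348142882162406461,
   22326466694627342551486195778163459956661324021230011792374485917276154142808290148586667413111526619394139570046592009480368,
   7283811829452891896229539048195171333378871666500571223044158526203568018221144303794231922008015776539932058313072570468772,
   2377355249890874438352696772674812865755603946705047551965801741191442339280512376932839585655394038176227824588294519528002,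
   776279265270489612523329558424428690858972717291444098601078119572715865887514245529090476948700094098360105988014536988735,
   253584559988359940090954322418646705680597754315205072209685519060420516189921320206169555803242030738797634622751415416320,
   82870771238026124212730170725047943032875083109544141244995267666804090258144222289597894053347068868888115889788044253699,
   27092367520123925223392555813957981376132238708889430791633068275685952584393303440830080748209618668674960963969168313709,
   8860396924820403217713288693873050512948908256995285541917733020979053675399067791969586156647170885352817422178595926496,
   2898771833428897349004964819600442451767235417412037862479258334024011387630559215891284359890741092121600761576948050027,
   948688963667639132401624850051053893305640682062121482265939091135130999588183016109874881418787993785251158334273907281,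
   310582696438810430250531944957190262689346651865575485265634821502572648674702773131209038559722259870171510168958719646,
   101711292401013942070349642792997980763762646224983784648395029264000399565984533890922258241780389197249149529015721054,
   33319216476194222402355917466671752319163625487494688074474233724413923995753554205646946665410817150822997259505150000,
   10918161331182287566873690469304867991590340555224248069601726305175184134201729626709168963806934433603016051137280791,
   3578730658554194258030820764938817841687944959767947978369454733362977021766122488754672049247828508792099705650553148,
   1173354314280063691157646152438956669405883593366540320776870404381303941562663111067105589917320822554786788737886278,
   384809748231633791186109759670840628138488705351392255738651046598169572232916396640287317123422420300225774801134747,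
   126233885663287275415549233331175232511038622919504337861356427984584727399157759744432876516678254278380941998255843,
   41420493733266137245727092186791873167684548145462360860757577932441863677848639916142037607035052185093746593177698,
   13594418456046321967828378974126563501188774775946621000453769167570662950678527972477386701796119691517947599812168,
   4462814139611166302569922390496094078673082628467325075906540383293399453505577364702172402104786767417508050443388,
   1465401657782771024724452128222598055683698773526584353282744603469474447419741821245489445467243416166942941936635,
   481283877801204209100677904857421910445136361893535057205607296237523470476091676585528396305418180799927338773307,
   158102916379139546950947331064273864300817742071306202367059401662568096581518038685101115694533508668575164427946,
   51948101096002993998168408778261412555982972394857752206319517689129517448213069853676080871061009991103268312039,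
   17072145900094880656675063917738492389290178721314754246208292198305475217722605116231575873118641781113750149497,
   5611677587531187623258933047034411850183345783395127553151799750368929353973634089131675402738072066940167873214,
   1844935097270527437783758809983916224717812312349083031173194438477456225963934495056989173502927802829644232290,
   606667847300668932244208978057774254073875219826500276016410783823668038267419901527748692187899682912450580888,
   199526314223331115493650952783445754673185627854048979667619546679784154807951434280237347652909229046761524381,
   65633655994516814307122023941922945616179482846726638048559061407823735134194550750078074885825404291697869862,
   21593756950576960551260925625914042713548228122732573557101682541102181256271800246778933728669829983415749392,
   7105637970916350266867911423911885850184673356625675914089015195149008362106532559837512380801610721038515826,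
   2338564395491457049855261987616570026643057054079336376788789811061698954617339829819940783554960490468372297,
   769777446849271278910690404257120967103339613634448224026309979474475905894874360649063841253507828112505881,
   253424673859842396349198486998229124972292876916690773341995054971020874368682917086111552676051959872429920,
   83444709685557862212540965231124224076242776545739644880900810783141019609200472699085511246992718494580583,
   27479783912513030929431161240771832828320914364460445302144042105291420112266822334638602097403224564480353,
   9050881209280085583899945964222468749010459889881813333642680534679316941738675610218269738430427138301069,
   2981466751292263486461158670567401470262269140196362039317588882012010286690387259836606502071199527910940,
   982266177751327117632552275186934592915863864018181292023236647174499513056910531341517646031209146792364,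
   323658587305034988951722205617150862033579664005990770551717822440639686294614198066553707121394584766833,
   106660216270977439540908454123833806806520571092883322113634282395210805710725133453750653483186851798161,
   35153928958224774080898666527705524340725881109264915153557366482316670046980568329326058076855591603888,
   11587776582525944048888819707280709875276308958239175735802243025652531978449150301148219143852398713874,
   3820146126107454082051259244158475783058123832386541451363376821643691861027192406971940377094197378200,
   1259540932883254787922697794269642377747424886765127797369809024527449128092298945776980341723086816725,
   415332493997345664834724720691064870081588134703913108810116237478585375571654132657642263220516082935,
   136971354403379953296558152568329903963076938040652195458655354913150496199162533110499044253574452883,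
   45176516890939353017110408215519336745716604125688794291626678462582970676215010920655825122231573933,
   14901976057775133807727391598869225662649574277570956450362966853977021577223701518966331203513887235,
   4916115812874270946879139496534177538193673988477016560944483910590357633723282975329098953736540119,
   1621983788601375108324069833890527963281586315926090497998690269820628198881491321792253736436885685,
   535200037989679328672588699398221348153520063840932218194854028425661829933960099446602242999376421,
   176616012536594178461954270801413044890661621067507632004301829380468403878206832817378740189794219,
   58289113048380916984143323696835988412759610913368855446964300125567129992807535583293313593991491,
   19239217051916577174504822527387041927087322556373380392625471610072810879978957823243871480369741,
   6350809512283141979933630737195722577873485115696067314070544026625976406983345300876617770219138,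
   2096581345401165461324243480548587902310797970886842735093801393405370416407963352532985994655677,
   692204634672130818976893085641438545524834885626132204602397920362408010496597424328350931568858,
   228558134089854515699917528277833482012917179216175727934754030308342267616801036334832854763302,
   75474025587303983377542859805141274434172028027771424177831548949172212982495046266331098457664,
   24925064005683722905546561725771964087828416663492414774777702893708107373848672686720455354846,
   8232131231234991051373176349796245019833238531061714971486213799756806105124332263504003603435,
   2719097891529133407877806733720577900490372726926445248157567588404520804419855202187686038710,
   898200504709323347947623845973764471633456456342069000892890194367859725183735952674611003778,
   296726952448615748875554306259190048664624007898719223509258367782239373498198484365719706605,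
   98033683404852400808442720652003791889197312344119625466185655432480264990555251471860198052,
   32391246271193921904543939864550960478009638289138940578008710713070964748341355018480123918,
   10703194420046687238023214911764665201429271782498084712733313105188666612495404266976040947,
   3536975167544163886128361249577403730357374295940459028633135077864070863324630720408749163,
   1168914870185535643278888618093956788380214867034453696072489085561915157110134369137934196,
   386336270654541441422683526319189108023969320460539780905314189295887212943180003359147743,
   127696582457243389601895395253961665957502464465948723100355950523570563381779384863807937,
   42210814756699898229515422320059550691507759087355272358173216978624714006754852218869846,
   13953988349322280406451379279358529154217441020613313176255608918553624465042926353345404,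
   4613203798546436964974363095088475485410684053262871295975214970341498798552442865450256,
   1525232692202345012809952026018411949105971421403984547720802781522121553992948589661060,
   504310809518517302622645427957700725107619582883575535939942855180701481562184614323415,
   166758774347456388067221421511346373102252875406835643884141104113085289903229045802943,
   55145097337121821450800734626767980523231770967868929855866767233163124967999023082984,
   18236961324087531503414416175781536865950664414570827196428379714904340540598102121932,
   6031495021247699221181330349802747869728474949610664202985427666127216793374893149701,
   1994913081963063308297700994250004463372725564729108573597247393447761626749318664501,
   659855865572397863513854944251924553269439994487320528189858753217336538078620789027,
   218272932632090896327738276724555195737982695377485161996645389104971373919136647770,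
   72206449936373503583165945078072552125443770440531707630203398921089015109613386005,
   23887848099251384644054899123572874387364856386341316809992101898706140337014954768,
   7903193525374214322535576078196995755023696267122873471962561075940091206027335782,
   2614883783704061035110536282662709706600432838998679124056748602903635115080649370,
   865218899019726077793927446469278947036907924668680592518777111254879266019332512,
   286301144201174565888014921459420770795667829087446619422271744843463698731457960,
   94742166076234095475019430531257598065233073876763736378867703003754895473936571,
   31353522586379628718351753988761507273386484880080085420344707468868526559720016,
   10376522951206591409168794772471070264287431900788409222447415090887440932859720,
   3434310196616838764263903707200827037825627579457156716649262677835086833570593,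
   1136708304514024098031010381960837118153552790383706800581093984917247050548013,
   376253098463849468345928844378645386428448709171296889702832974028552636778130,
   124546743241505726790434779504968264489046679193276516730335915014081081155724,
   41229266728222585420281858043023977210167176560532915883145682211557875141205,
   13648958163452682387992852548489672820717444295153590874557360549488337660901,
   4518702702639663557022577034193859936110537113588263645545067211395231969369,
   1496056975873942664149366720780399573442002152471789990754785765934907881750,
   495338775009717034215002851623040574651938072854194448840510723396792766217,
   164012172169884084662300944204073434718086161900611050838302439524715827036,
   54308666281418571080232100729825640635127868179010281734537231630700604979,
   17983790808101325072620717566236122227860324769803843293673513105780244193,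
   5955416563902835318166337843285164659335009509826109326009529394506747532,
   1972248342591198709262878116932099984584970681825529711860298695583403404,
   653174719911923873605340279586114833604484913980928119626851611010417471,
   216329234158863676087238767811640596599775986468042432782397435270544248,
   71650446982553574245454878510861853650881218448014054169966029516358604,
   23732321046963947587629569464568166715587239021810562246170182772295993,
   7861020388721810731332226363525723985456569738880647452609829932961776,
   2603963003764099804753799982917896070182488726004214468677006165293588,
   862596440170302212754881981918971783083226079007607277408532063037213,
   285757256928844971715094648331182010445266252510750558976900539401217,
   94668048307715512101933196379655389963462439482089142237746190967274,
   31363601370239082261412827255861440170821905763375061351123229934280,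
   10391172979230726244185259939315709470736954636754565780978201432772,
   3442858517214999659218007811219060366810436777237958541890367944593,
   1140747532650079727405567458407912217346372265511978279348904348907,
   377985789588419274755416201496272500588976524485119787006482194975,
   125249729094387451989960398128942367059069144208087030013982265791,
   41504321994022508600594720164296588299966049747385702102672554742,
   13753868886908043785772129489143118929813310832466996798156597088,
   4557968177638130789470996400471847552321853008433830334272825779,
   1510540513591056831963413065281614217725161305299843578988296790,
   500619748757189333198602414355784022349526639495925170814129013,
   165919688159525607574393943043631275978700257661506628041254187,
   54992320886206404025604053092112638818698002065840264975794475,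
   18227209935917753500011889537122079909775608970975304398756737,
   6041603293365996946633154397135970307172814209480578424307008,
   2002617106553347218809499967765740623234191674650917987945340,
   663830485320461392901667581907532539923926499560211703411511,
   220054304526119798751934005052220731466494972229904432070114,
   72948404980270482736446987022805773618013901050572714660606,
   24183259938814622692228327209746176317811530038623377173461,
   8017276392759195566445260651057156279274474632369706562941,
   2657979921203048620226897224854985144840546544785632446092,
   881229902190974900971283130104251347303765431514949825317,
   292172480940323229199035048483762478785205651090518123902,
   96872790666383765709609138415715573639775632542423562358,
   32120078739471160411651707270113805721830368462038147660,
   10650341897824647925968723989564051370922701121623175277,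
   3531526981826672087144952108232407958944700197396864402,
   1171044537376552723341468494222899166941732183511807467,
   388325649699996757999243438498785215980678029765573460,
   128774657031098581260917497646504375746169862104391199,
   42704758058176281648919648792174100674798210680772466,
   14162292213170705648876414140261819101336141297194950,
   4696800801660673954618912303707811410933813357445364,
   1557693195163556850269235225303769104299598032688109,
   516621863722586694059143341055521411476248593755855,
   171346251467991253529615874783414601472955783595692,
   56831260851738392547136276876754428349239065869218,
   18849972658744912379495695795755181680193155511077,
   6252371883524585058551938506966414941541900514347,
   2073907667247533932820332543977421949563734974530,
   687930348160157597228207868246169232050409650088,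
   228196960150214089695441121343794000922870514997,
   75698186458847185953721209334656303043657529935,
   25111417623367576109647901173515792836597930603,
   8330422433270264482945396242569832392364225782, 2763584585005532185612044150312849158736703474,
   916829009243541483378403272615637161666204944, 304168114701866749988746997675942517471020823,
   100913365128005870105812775441783746015424749, 33480602449011293352863117085825448444369893,
   11108292905563436864360786133901776693170786, 3685621874531078589255507745044570970727961,
   1222879147309850960490306717249811566324485, 405756536645623330927211861839769281181060,
   134634589023966341160018547764185240939834, 44674204539770649566733427212661466311854,
   14824019605957078287603852167097319138172, 4919081580955727179520197190583344638943,
   1632340973052573144773518350238419297228, 541684578855243766792402666820189737026,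
   179759030612703116683701033137366668287, 59654545557312981200343263209303097883,
   19797250067478316815385576336714390781, 6570140007774236720895505597125974718,
   2180483146684899523091958189439188116, 723667595059191290997186123741411708,
   240178278302473300042356144964682096, 79714342367631224583023375699485006,
   26457406908856143209243809960344094, 8781447022455101663466962565185433,
   2914693054261693318086906723763676, 967447553321324759534495875825514,
   321121832044771650140845325871760, 106590860216541850256835213209534,
   35381624451237043739367895040264, 11744733672007852019040176270310,
   3898666779089743408810017019190, 1294185528595906558571920250172,
   429619887407694632612352126943, 142619716721406824760657878207, 47345865142888796247075540520,
   15717800758818096315086053425, 5218055312644064363712778870, 1732338255676188034727226318,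
   575127024642161489440899768, 190942172181197614494378723, 63393815465205051292954423,
   21047417568474163855200477, 6988075398228576141647589, 2320187763453844834431549,
   770362995970296193392959, 255784588505762407962506, 84929772577788815095203,
   28200195804252875296469, 9363771579790530021221, 3109252357904804199354,
   1032446504540548010003, 342835289675678155993, 113843911147056624677, 37804228070297843801,
   12553856868627208507, 4168887305997757211, 1384424498620978050, 459752911855474054,
   152681264408013688, 50705259414513188, 16839385045410284, 5592491847188955, 1857335509689128,
   616852304312813, 204869735008134, 68042484453185, 22598947905029, 7505885575171, 2492994253163,
   828030234086, 275027835758, 91350853248, 30342686238, 10078615264, 3347750567, 1112015049,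
   369380144, 122699191, 40758209, 13539221, 4497565, 1494054, 496318, 164877, 54773, 18196, 6045,
   2008, 667, 222, 74, 24, 8, 3, 1, 0, 0, 0, 0]

/-- The coefficient list of a sum. -/
def addCoeffs : List ℤ → List ℤ → List ℤ
  | [], m => m
  | l, [] => l
  | a :: l, b :: m => (a + b) :: addCoeffs l m

/-- `homEval l T S` is the sum of `l[k] * T ^ k * S ^ (n - k)`, where `n + 1` is the length
of `l`. -/
def homEval {R : Type*} [CommRing R] : List ℤ → R → R → R
  | [], _, _ => 0
  | a :: l, T, S => (a : R) * S ^ l.length + T * homEval l T S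

/-- The sum of the absolute values of the entries. -/
def absSum : List ℤ → ℤ
  | [] => 0
  | a :: l => |a| + absSum l

/-- Multiplication of the entries by `k`, `k + 1`, .... -/
def weightCoeffs : ℤ → List ℤ → List ℤ
  | _, [] => []
  | k, a :: l => k * a :: weightCoeffs (k + 1) l

/-- The coefficient list of the derivative. -/
def derivCoeffs (l : List ℤ) : List ℤ := weightCoeffs 1 l.tail

/-- The `n` lowest balanced digits of `V` in base `b`. -/
def balancedDigits (b : ℤ) : ℕ → ℤ → List ℤ
  | 0, _ => []
  | n + 1, V => ((V + b / 2) % b - b / 2) :: balancedDigits b n ((V + b / 2) / b)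

/-- The coefficient list of the quotient by `X - 4`. -/
def quotFour : List ℤ → List ℤ
  | [] => []
  | _ :: l => homEval l (4 : ℤ) 1 :: quotFour l

/-- The sum of the rounded values of `l[i] * ∫ x in 0..1, (2 * x - 1) ^ (k + i)`. -/
def momentSum : ℕ → List ℤ → ℤ
  | _, [] => 0
  | k, a :: l => (if k % 2 = 0 then a / (k + 1 : ℤ) else 0) + momentSum (k + 1) l

/-- A rounded partial sum of `N * (-log (1 - a / b))`. -/
def logSum (N a b : ℤ) : ℕ → ℤ
  | 0 => 0
  | n + 1 => N * a ^ (n + 1) / (b ^ (n + 1) * (n + 1 : ℤ)) + logSum N a b n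

/-- The coefficient list of the approximate distribution function. -/
def cdfCoeffs : List ℤ := addCoeffs leftCoeffs rightCoeffs

/-- The defect of the functional equation for the distribution function on the left branch. -/
def leftDefect {R : Type*} [CommRing R] (x : R) : R :=
  homEval cdfCoeffs (1100 * x - 1400) 2500 -
    homEval leftCoeffs (129 + 2508 * x - 121 * x ^ 2) 2500

/-- The defect of the functional equation for the distribution function on the right branch. -/
def rightDefect {R : Type*} [CommRing R] (x : R) : R :=
  homEval cdfCoeffs (576 * x + 448) 1024 -
    homEval rightCoeffs (79 + 1026 * x - 81 * x ^ 2) 1024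

/-- The coefficient list of `leftDefect`. -/
def leftDigits : List ℤ := balancedDigits ((2 ^ 64) ^ 64) 621 (leftDefect (((2 : ℤ) ^ 64) ^ 64))

/-- The coefficient list of `rightDefect`. -/
def rightDigits : List ℤ := balancedDigits ((2 ^ 64) ^ 64) 621 (rightDefect (((2 : ℤ) ^ 64) ^ 64))

theorem leftDigits_spec :
    homEval leftDigits (((2 : ℤ) ^ 64) ^ 64) 1 = leftDefect (((2 : ℤ) ^ 64) ^ 64) := by
  decide +kernel

theorem rightDigits_spec :
    homEval rightDigits (((2 : ℤ) ^ 64) ^ 64) 1 = rightDefect (((2 : ℤ) ^ 64) ^ 64) := by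
  decide +kernel

theorem leftDefect_majorant_add_absSum_lt :
    homEval (cdfCoeffs.map abs) (2500 : ℤ) 2500 + homEval (leftCoeffs.map abs) (2758 : ℤ) 2500 +
      absSum leftDigits < (2 ^ 64) ^ 64 := by
  decide +kernel

theorem rightDefect_majorant_add_absSum_lt :
    homEval (cdfCoeffs.map abs) (1024 : ℤ) 1024 + homEval (rightCoeffs.map abs) (1186 : ℤ) 1024 +
      absSum rightDigits < (2 ^ 64) ^ 64 := by
  decide +kernel

theorem absSum_derivCoeffs_leftDigits_le :
    absSum (derivCoeffs leftDigits) * 50 * 10 ^ 132 ≤ 11 * (10 ^ 148 * 2500 ^ 309) := by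
  decide +kernel

theorem absSum_derivCoeffs_derivCoeffs_leftDigits_le :
    absSum (derivCoeffs (derivCoeffs leftDigits)) * 2500 * 10 ^ 132 ≤
      121 * (10 ^ 148 * 2500 ^ 309) := by
  decide +kernel

theorem absSum_derivCoeffs_rightDigits_le :
    absSum (derivCoeffs rightDigits) * 32 * 10 ^ 132 ≤ 9 * (10 ^ 148 * 1024 ^ 309) := by
  decide +kernel

theorem absSum_derivCoeffs_derivCoeffs_rightDigits_le :
    absSum (derivCoeffs (derivCoeffs rightDigits)) * 1024 * 10 ^ 132 ≤
      81 * (10 ^ 148 * 1024 ^ 309) := by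
  decide +kernel

theorem homEval_cdfCoeffs_one_sub :
    homEval cdfCoeffs (1 : ℤ) 1 - homEval cdfCoeffs (-1 : ℤ) 1 = 10 ^ 148 := by
  decide +kernel

theorem length_coeffs :
    cdfCoeffs.length = 310 ∧ leftCoeffs.length = 310 ∧ rightCoeffs.length = 310 := by
  decide +kernel

theorem length_quotFour_cdfCoeffs : (quotFour cdfCoeffs).length = 310 := by
  decide +kernel

/-- An integer approximation of `10 ^ 338` times the Lyapunov exponent. -/
def lyapunovSum : ℤ :=
  logSum (10 ^ 190) 1 3 480 * (homEval cdfCoeffs (1 : ℤ) 1 - homEval cdfCoeffs (4 : ℤ) 1) -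
    (logSum (10 ^ 190) 1 3 480 + logSum (10 ^ 190) 2 5 480) *
      (homEval cdfCoeffs (-1 : ℤ) 1 - homEval cdfCoeffs (4 : ℤ) 1) -
    2 * 10 ^ 190 * momentSum 0 (quotFour cdfCoeffs)

theorem abs_lyapunovSum_sub_le :
    |10 ^ 128 * lyapunovSum -
      65766178000659767754158241382383206574324106958001220195395280269163266611155402375955645975291517482964215633179802630148859489 *
        10 ^ 338| ≤ 10 ^ 338 := by
  decide +kernel

theorem abs_homEval_cdfCoeffs_sub_le :
    |homEval cdfCoeffs (1 : ℤ) 1 - homEval cdfCoeffs (4 : ℤ) 1| ≤ 10 ^ 186 ∧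
      |homEval cdfCoeffs (-1 : ℤ) 1 - homEval cdfCoeffs (4 : ℤ) 1| ≤ 10 ^ 186 := by
  decide +kernel

section HomEval

variable {R : Type*} [CommRing R]

theorem map_homEval {S : Type*} [CommRing S] (f : R →+* S) (l : List ℤ) (a b : R) :
    f (homEval l a b) = homEval l (f a) (f b) := by
  induction l with
  | nil => simp [homEval]
  | cons c l ih => simp [homEval, ih]

theorem homEval_addCoeffs (l m : List ℤ) (h : l.length = m.length) (a b : R) :
    homEval (addCoeffs l m) a b = homEval l a b + homEval m a b ∧
      (addCoeffs l m).length = l.length := by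
  induction l generalizing m with
  | nil =>
    cases m with
    | nil => simp [addCoeffs, homEval]
    | cons => simp at h
  | cons c l ih =>
    cases m with
    | nil => simp at h
    | cons d m =>
      have hlm : l.length = m.length := by simpa using h
      obtain ⟨h1, h2⟩ := ih m hlm
      refine ⟨?_, by simp [addCoeffs, h2]⟩
      simp only [addCoeffs, homEval, h1, h2, hlm]
      push_cast
      ring

theorem homEval_scale (l : List ℤ) (a b : R) :
    b * homEval l (b * a) b = b ^ l.length * homEval l a 1 := by
  induction l with
  | nil => simp [homEval]
  | cons c l ih =>
    simp only [homEval, one_pow, mul_one, List.length_cons, pow_succ]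
    linear_combination b * a * ih

theorem homEval_weightCoeffs (k : ℤ) (l : List ℤ) (s : R) :
    homEval (weightCoeffs k l) s 1 = k * homEval l s 1 + s * homEval (derivCoeffs l) s 1 := by
  induction l generalizing k with
  | nil => simp [weightCoeffs, homEval, derivCoeffs]
  | cons c l ih =>
    have h1 := ih 1
    simp only [weightCoeffs, homEval, derivCoeffs, List.tail_cons, one_pow, mul_one, ih (k + 1)]
    simp only [derivCoeffs] at h1
    rw [h1]
    push_cast
    ring

theorem homEval_quotFour (l : List ℤ) (t : R) :
    homEval l t 1 = ((homEval l (4 : ℤ) 1 : ℤ) : R) + (t - 4) * homEval (quotFour l) t 1 := by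
  induction l with
  | nil => simp [quotFour, homEval]
  | cons c l ih =>
    simp only [quotFour, homEval, one_pow, mul_one]
    push_cast
    linear_combination t * ih

end HomEval

theorem hasDerivAt_homEval (l : List ℤ) (s : ℝ) :
    HasDerivAt (fun s : ℝ => homEval l s 1) (homEval (derivCoeffs l) s 1) s := by
  induction l with
  | nil => simpa [homEval, derivCoeffs, weightCoeffs] using hasDerivAt_const s (0 : ℝ)
  | cons c l ih =>
    have h := ((hasDerivAt_id s).mul ih).const_add (c : ℝ)
    simp only [homEval, one_pow, mul_one]
    refine h.congr_deriv ?_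
    simp only [derivCoeffs, List.tail_cons, homEval_weightCoeffs 1 l, id]
    push_cast
    ring

theorem abs_homEval_le (l : List ℤ) {s : ℝ} (hs : |s| ≤ 1) : |homEval l s 1| ≤ absSum l := by
  induction l with
  | nil => simp [homEval, absSum]
  | cons c l ih =>
    simp only [homEval, absSum, one_pow, mul_one]
    push_cast
    refine (abs_add_le _ _).trans ?_
    rw [abs_mul]
    gcongr
    exact (mul_le_of_le_one_left (abs_nonneg _) hs).trans ih

theorem homEval_map_abs (l : List ℤ) : homEval (l.map abs) (1 : ℤ) 1 = absSum l := by
  induction l with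
  | nil => simp [homEval, absSum]
  | cons c l ih => simp [homEval, absSum, ih]

section Majorant

open Polynomial

/-- `g` dominates `f` coefficientwise. -/
def Majorant (f g : ℤ[X]) : Prop := ∀ k, |f.coeff k| ≤ g.coeff k

theorem Majorant.add {f g f' g' : ℤ[X]} (h : Majorant f g) (h' : Majorant f' g') :
    Majorant (f + f') (g + g') := fun k => by
  simp only [coeff_add]
  exact (abs_add_le _ _).trans (add_le_add (h k) (h' k))

theorem Majorant.sub {f g f' g' : ℤ[X]} (h : Majorant f g) (h' : Majorant f' g') :
    Majorant (f - f') (g + g') := fun k => by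
  simp only [coeff_add, coeff_sub]
  exact (abs_sub _ _).trans (add_le_add (h k) (h' k))

theorem Majorant.mul {f g f' g' : ℤ[X]} (h : Majorant f g) (h' : Majorant f' g') :
    Majorant (f * f') (g * g') := fun k => by
  simp only [coeff_mul]
  refine (Finset.abs_sum_le_sum_abs _ _).trans (Finset.sum_le_sum fun i _ => ?_)
  rw [abs_mul]
  exact mul_le_mul (h _) (h' _) (abs_nonneg _) ((abs_nonneg _).trans (h _))

theorem majorant_C (a : ℤ) : Majorant (C a) (C |a|) := fun k => by
  rw [coeff_C, coeff_C]
  split_ifs <;> simp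

theorem majorant_X : Majorant X X := fun k => by
  rw [coeff_X]
  split_ifs <;> simp

theorem Majorant.pow {f g : ℤ[X]} (h : Majorant f g) (n : ℕ) : Majorant (f ^ n) (g ^ n) := by
  induction n with
  | zero => simpa using majorant_C 1
  | succ n ih =>
    rw [pow_succ, pow_succ]
    exact ih.mul h

theorem Majorant.homEval {f g f' g' : ℤ[X]} (h : Majorant f g) (h' : Majorant f' g')
    (l : List ℤ) : Majorant (homEval l f f') (homEval (l.map abs) g g') := by
  induction l with
  | nil => simpa [_root_.homEval] using majorant_C 0
  | cons c l ih =>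
    simp only [_root_.homEval, List.map_cons, List.length_map]
    exact ((majorant_C c).mul (h'.pow _)).add (h.mul ih)

theorem Majorant.coeff_le {f g : ℤ[X]} (h : Majorant f g) (k : ℕ) :
    |f.coeff k| ≤ g.eval 1 := by
  have h0 : ∀ k, 0 ≤ g.coeff k := fun k => (abs_nonneg _).trans (h k)
  refine (h k).trans ?_
  rw [eval_eq_sum_range]
  simp only [one_pow, mul_one]
  rcases le_or_gt k g.natDegree with hk | hk
  · exact Finset.single_le_sum (fun i _ => h0 i) (Finset.mem_range_succ_iff.2 hk)
  · rw [coeff_eq_zero_of_natDegree_lt hk]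
    exact Finset.sum_nonneg fun i _ => h0 i

/-- A root of an integer polynomial that exceeds all coefficients forces it to vanish. -/
theorem eq_zero_of_eval_eq_zero {b : ℤ} (n : ℕ) {f : ℤ[X]} (hn : f.natDegree ≤ n)
    (hf : ∀ k, |f.coeff k| < b) (h0 : f.eval b = 0) : f = 0 := by
  have hb : b ≠ 0 := ((abs_nonneg _).trans_lt (hf 0)).ne'
  induction n generalizing f with
  | zero =>
    rw [eq_C_of_natDegree_le_zero hn, eval_C] at h0
    rw [eq_C_of_natDegree_le_zero hn, h0, map_zero]
  | succ n ih =>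
    have hdiv := divX_mul_X_add f
    have hc : f.coeff 0 = 0 := by
      refine Int.eq_zero_of_abs_lt_dvd (m := b) ⟨-f.divX.eval b, ?_⟩ (hf 0)
      rw [← hdiv] at h0
      simp only [eval_add, eval_mul, eval_X, eval_C] at h0
      linarith
    rw [hc, map_zero, add_zero] at hdiv
    have hd0 : f.divX.eval b = 0 := by
      rw [← hdiv, eval_mul, eval_X] at h0
      exact (mul_eq_zero.1 h0).resolve_right hb
    rw [← hdiv, ih _ (fun k => ?_) hd0, zero_mul]
    · rw [natDegree_divX_eq_natDegree_tsub_one]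
      omega
    · rw [coeff_divX]
      exact hf _

theorem eq_of_eval_eq {b : ℤ} {f f' g g' : ℤ[X]} (h : Majorant f g) (h' : Majorant f' g')
    (hb : g.eval 1 + g'.eval 1 < b) (heval : f.eval b = f'.eval b) : f = f' := by
  rw [← sub_eq_zero]
  refine eq_zero_of_eval_eq_zero (b := b) _ le_rfl (fun k => ?_) (by simp [heval])
  refine ((h.sub h').coeff_le k).trans_lt ?_
  rwa [eval_add]

theorem eval_one_homEval (l : List ℤ) (f g : ℤ[X]) :
    (homEval l f g).eval 1 = homEval l (f.eval 1) (g.eval 1) :=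
  map_homEval (evalRingHom 1) l f g

theorem majorant_ofNat (n : ℕ) [n.AtLeastTwo] :
    Majorant (OfNat.ofNat n : ℤ[X]) (OfNat.ofNat n) := by
  simpa using majorant_C (OfNat.ofNat n)

theorem majorant_one : Majorant 1 1 := by
  simpa using majorant_C 1

theorem homEval_X (l : List ℤ) (s : ℝ) :
    aeval s (homEval l (X : ℤ[X]) 1) = homEval l s 1 := by
  simpa using map_homEval ((aeval s : ℤ[X] →ₐ[ℤ] ℝ) : ℤ[X] →+* ℝ) l X 1

theorem leftDefect_map {R S : Type*} [CommRing R] [CommRing S] (f : R →+* S) (x : R) :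
    f (leftDefect x) = leftDefect (f x) := by
  simp [leftDefect, map_homEval, map_ofNat f]

theorem rightDefect_map {R S : Type*} [CommRing R] [CommRing S] (f : R →+* S) (x : R) :
    f (rightDefect x) = rightDefect (f x) := by
  simp [rightDefect, map_homEval, map_ofNat f]

theorem majorant_leftDefect : Majorant (leftDefect X)
    (homEval (cdfCoeffs.map abs) (1100 * X + 1400) 2500 +
      homEval (leftCoeffs.map abs) (129 + 2508 * X + 121 * X ^ 2) 2500) := by
  have hS : Majorant (2500 : ℤ[X]) 2500 := majorant_ofNat 2500
  have hT : Majorant (1100 * X - 1400 : ℤ[X]) (1100 * X + 1400) :=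
    ((majorant_ofNat 1100).mul majorant_X).sub (majorant_ofNat 1400)
  have hU : Majorant (129 + 2508 * X - 121 * X ^ 2 : ℤ[X]) (129 + 2508 * X + 121 * X ^ 2) :=
    ((majorant_ofNat 129).add ((majorant_ofNat 2508).mul majorant_X)).sub
      ((majorant_ofNat 121).mul (majorant_X.pow 2))
  rw [leftDefect]
  convert (hT.homEval hS cdfCoeffs).sub (hU.homEval hS leftCoeffs) using 3

theorem leftDefect_eq (s : ℝ) : leftDefect s = homEval leftDigits s 1 := by
  have key : leftDefect (X : ℤ[X]) = homEval leftDigits X 1 := by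
    refine eq_of_eval_eq (b := (2 ^ 64) ^ 64) majorant_leftDefect
      (majorant_X.homEval majorant_one leftDigits) ?_ ?_
    · have h := leftDefect_majorant_add_absSum_lt
      rw [← homEval_map_abs] at h
      simp only [eval_add, eval_one_homEval, eval_mul, eval_X, eval_ofNat, eval_pow, eval_one]
      norm_num only at h ⊢
      exact h
    · have h := leftDigits_spec
      have h1 := leftDefect_map (evalRingHom (((2 : ℤ) ^ 64) ^ 64)) (X : ℤ[X])
      have h2 := map_homEval (evalRingHom (((2 : ℤ) ^ 64) ^ 64)) leftDigits (X : ℤ[X]) 1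
      simp only [coe_evalRingHom, eval_X, eval_one] at h1 h2
      rw [h1, h2, h]
  have h := congrArg (aeval s) key
  rw [homEval_X] at h
  rw [← h]
  simpa using (leftDefect_map ((aeval s : ℤ[X] →ₐ[ℤ] ℝ) : ℤ[X] →+* ℝ) X).symm

theorem majorant_rightDefect : Majorant (rightDefect X)
    (homEval (cdfCoeffs.map abs) (576 * X + 448) 1024 +
      homEval (rightCoeffs.map abs) (79 + 1026 * X + 81 * X ^ 2) 1024) := by
  have hS : Majorant (1024 : ℤ[X]) 1024 := majorant_ofNat 1024
  have hT : Majorant (576 * X + 448 : ℤ[X]) (576 * X + 448) :=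
    ((majorant_ofNat 576).mul majorant_X).add (majorant_ofNat 448)
  have hU : Majorant (79 + 1026 * X - 81 * X ^ 2 : ℤ[X]) (79 + 1026 * X + 81 * X ^ 2) :=
    ((majorant_ofNat 79).add ((majorant_ofNat 1026).mul majorant_X)).sub
      ((majorant_ofNat 81).mul (majorant_X.pow 2))
  rw [rightDefect]
  convert (hT.homEval hS cdfCoeffs).sub (hU.homEval hS rightCoeffs) using 3

theorem rightDefect_eq (s : ℝ) : rightDefect s = homEval rightDigits s 1 := by
  have key : rightDefect (X : ℤ[X]) = homEval rightDigits X 1 := by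
    refine eq_of_eval_eq (b := (2 ^ 64) ^ 64) majorant_rightDefect
      (majorant_X.homEval majorant_one rightDigits) ?_ ?_
    · have h := rightDefect_majorant_add_absSum_lt
      rw [← homEval_map_abs] at h
      simp only [eval_add, eval_one_homEval, eval_mul, eval_X, eval_ofNat, eval_pow, eval_one]
      norm_num only at h ⊢
      exact h
    · have h := rightDigits_spec
      have h1 := rightDefect_map (evalRingHom (((2 : ℤ) ^ 64) ^ 64)) (X : ℤ[X])
      have h2 := map_homEval (evalRingHom (((2 : ℤ) ^ 64) ^ 64)) rightDigits (X : ℤ[X]) 1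
      simp only [coe_evalRingHom, eval_X, eval_one] at h1 h2
      rw [h1, h2, h]
  have h := congrArg (aeval s) key
  rw [homEval_X] at h
  rw [← h]
  simpa using (rightDefect_map ((aeval s : ℤ[X] →ₐ[ℤ] ℝ) : ℤ[X] →+* ℝ) X).symm

end Majorant

section LanfordTransfer

open MeasureTheory Set

/-- The inverse branch of the Lanford map onto the left (`c = 25`) or right (`c = 17`) interval. -/
noncomputable def invBranch (c x : ℝ) : ℝ := (5 - √(c - 8 * x)) / 2

/-- The derivative of `invBranch c`. -/
noncomputable def branchWeight (c x : ℝ) : ℝ := 2 / √(c - 8 * x)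

/-- The transfer operator of the Lanford map. -/
noncomputable def transferOp (φ : ℝ → ℝ) (x : ℝ) : ℝ :=
  φ (invBranch 25 x) * branchWeight 25 x + φ (invBranch 17 x) * branchWeight 17 x

theorem hasDerivAt_invBranch {c x : ℝ} (hx : 0 < c - 8 * x) :
    HasDerivAt (invBranch c) (branchWeight c x) x := by
  have h1 : HasDerivAt (fun x : ℝ => c - 8 * x) (-8) x := by
    simpa using ((hasDerivAt_id x).const_mul 8).const_sub c
  have h2 := ((h1.sqrt hx.ne').const_sub 5).div_const 2
  have hs := Real.sqrt_pos.2 hx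
  refine HasDerivAt.congr_deriv h2 ?_
  unfold branchWeight
  field_simp
  norm_num

theorem hasDerivAt_branchWeight {c x : ℝ} (hx : 0 < c - 8 * x) :
    HasDerivAt (branchWeight c) (branchWeight c x ^ 3) x := by
  have h1 : HasDerivAt (fun x : ℝ => c - 8 * x) (-8) x := by
    simpa using ((hasDerivAt_id x).const_mul 8).const_sub c
  have hs := Real.sqrt_pos.2 hx
  have h2 := (hasDerivAt_const x (2 : ℝ)).div (h1.sqrt hx.ne') hs.ne'
  refine HasDerivAt.congr_deriv h2 ?_
  unfold branchWeight
  field_simp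
  norm_num

theorem branchWeight_pos {c x : ℝ} (hx : 0 < c - 8 * x) : 0 < branchWeight c x :=
  div_pos two_pos (Real.sqrt_pos.2 hx)

theorem inv_branchWeight {c x : ℝ} : (branchWeight c x)⁻¹ = 5 / 2 - invBranch c x := by
  unfold branchWeight invBranch
  rw [inv_div]; ring

theorem branchWeight_left_le {x : ℝ} (hx : x ≤ 1) : branchWeight 25 x ≤ 0.486 := by
  have : (4.1231 : ℝ) ≤ √(25 - 8 * x) := Real.le_sqrt_of_sq_le (by norm_num; linarith)
  unfold branchWeight
  rw [div_le_iff₀ (by linarith)]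
  linarith

theorem branchWeight_right_le {x : ℝ} (hx : x ≤ 1) : branchWeight 17 x ≤ 2 / 3 := by
  have : (3 : ℝ) ≤ √(17 - 8 * x) := Real.le_sqrt_of_sq_le (by norm_num; linarith)
  unfold branchWeight
  rw [div_le_iff₀ (by linarith)]
  linarith

theorem invBranch_left_mem {x : ℝ} (hx : x ∈ Icc (0 : ℝ) 1) :
    invBranch 25 x ∈ Icc (0 : ℝ) (11 / 25) := by
  obtain ⟨h0, h1⟩ := hx
  have h2 : (4.12 : ℝ) ≤ √(25 - 8 * x) := Real.le_sqrt_of_sq_le (by norm_num; linarith)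
  have h3 : √(25 - 8 * x) ≤ 5 := Real.sqrt_le_iff.2 ⟨by norm_num, by linarith⟩
  unfold invBranch
  constructor <;> linarith

theorem invBranch_right_mem {x : ℝ} (hx : x ∈ Icc (0 : ℝ) 1) :
    invBranch 17 x ∈ Icc (7 / 16 : ℝ) 1 := by
  obtain ⟨h0, h1⟩ := hx
  have h2 : (3 : ℝ) ≤ √(17 - 8 * x) := Real.le_sqrt_of_sq_le (by norm_num; linarith)
  have h3 : √(17 - 8 * x) ≤ 33 / 8 := Real.sqrt_le_iff.2 ⟨by norm_num, by linarith⟩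
  unfold invBranch
  constructor <;> linarith

theorem invBranch_eq_iff {c x y : ℝ} (hx : 0 ≤ c - 8 * x) (hy : y ≤ 5 / 2) :
    invBranch c x = y ↔ (5 * y - y ^ 2) / 2 = x + (25 - c) / 8 := by
  have : invBranch c x = y ↔ √(c - 8 * x) = 5 - 2 * y := by
    unfold invBranch
    constructor <;> intro h <;> linarith
  rw [this, Real.sqrt_eq_iff_mul_self_eq hx (by linarith)]
  constructor <;> intro h <;> linarith

/-- The point where the Lanford map jumps. -/
noncomputable def breakPoint : ℝ := (5 - √17) / 2

theorem breakPoint_mem : breakPoint ∈ Ioo (0 : ℝ) 1 := by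
  have h2 : (4 : ℝ) ≤ √17 := Real.le_sqrt_of_sq_le (by norm_num)
  have h3 : √17 < 5 := (Real.sqrt_lt' (by norm_num)).2 (by norm_num)
  unfold breakPoint
  constructor <;> linarith

theorem breakPoint_eq : (5 * breakPoint - breakPoint ^ 2) / 2 = 1 := by
  have : √17 * √17 = 17 := Real.mul_self_sqrt (by norm_num)
  unfold breakPoint
  linarith

theorem image_invBranch_left : invBranch 25 '' Ico 0 1 = Ico 0 breakPoint := by
  have hb := breakPoint_mem
  have hbe := breakPoint_eq
  ext y
  constructor
  · rintro ⟨x, ⟨h0, h1⟩, rfl⟩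
    have hm := invBranch_left_mem ⟨h0, h1.le⟩
    have := (invBranch_eq_iff (c := 25) (x := x) (by linarith) (by linarith [hm.2])).1 rfl
    refine ⟨hm.1, ?_⟩
    by_contra! h
    nlinarith [hm.2, hb.1, hb.2]
  · rintro ⟨h0, h1⟩
    refine ⟨(5 * y - y ^ 2) / 2, ⟨by nlinarith [hb.2], by nlinarith [hb.2]⟩, ?_⟩
    rw [invBranch_eq_iff]
    · ring
    · nlinarith [hb.2]
    · linarith [hb.2]

theorem image_invBranch_right : invBranch 17 '' Ico 0 1 = Ico breakPoint 1 := by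
  have hb := breakPoint_mem
  have hbe := breakPoint_eq
  ext y
  constructor
  · rintro ⟨x, ⟨h0, h1⟩, rfl⟩
    have hm := invBranch_right_mem ⟨h0, h1.le⟩
    have := (invBranch_eq_iff (c := 17) (x := x) (by linarith) (by linarith [hm.2])).1 rfl
    constructor
    · by_contra! h
      nlinarith [hm.2, hb.1, hb.2]
    · by_contra! h
      nlinarith [hm.2]
  · rintro ⟨h0, h1⟩
    refine ⟨(5 * y - y ^ 2) / 2 - 1, ⟨by nlinarith [hb.2], by nlinarith [hb.2]⟩, ?_⟩
    rw [invBranch_eq_iff]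
    · ring
    · nlinarith
    · linarith [hb.2]

theorem lanford_eq (y : ℝ) : lanford y = Int.fract ((5 * y - y ^ 2) / 2) := by
  unfold lanford
  congr 1
  ring

theorem measurable_lanford : Measurable lanford := by
  unfold lanford
  fun_prop

theorem lanford_invBranch_left {x : ℝ} (hx : x ∈ Ico (0 : ℝ) 1) : lanford (invBranch 25 x) = x := by
  have hm := invBranch_left_mem (Ico_subset_Icc_self hx)
  have := (invBranch_eq_iff (c := 25) (x := x) (by linarith [hx.2]) (by linarith [hm.2])).1 rfl
  rw [lanford_eq, this, sub_self, zero_div, add_zero, Int.fract_eq_self]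
  exact hx

theorem lanford_invBranch_right {x : ℝ} (hx : x ∈ Ico (0 : ℝ) 1) :
    lanford (invBranch 17 x) = x := by
  have hm := invBranch_right_mem (Ico_subset_Icc_self hx)
  have := (invBranch_eq_iff (c := 17) (x := x) (by linarith [hx.2]) (by linarith [hm.2])).1 rfl
  rw [lanford_eq, this, show ((25 : ℝ) - 17) / 8 = 1 by norm_num, Int.fract_add_one,
    Int.fract_eq_self]
  exact hx

theorem preimage_lanford {x : ℝ} (hx : x ∈ Ico (0 : ℝ) 1) :
    {y : ℝ | y ∈ Ico (0 : ℝ) 1 ∧ lanford y = x} = {invBranch 25 x, invBranch 17 x} := by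
  have h1 : invBranch 25 x ∈ Ico 0 breakPoint := image_invBranch_left ▸ mem_image_of_mem _ hx
  have h2 : invBranch 17 x ∈ Ico breakPoint 1 := image_invBranch_right ▸ mem_image_of_mem _ hx
  have hb := breakPoint_mem
  ext y
  simp only [mem_ofPred_eq, mem_insert_iff, mem_singleton_iff]
  constructor
  · rintro ⟨hy, rfl⟩
    rcases lt_or_ge y breakPoint with h | h
    · left
      have : y ∈ invBranch 25 '' Ico 0 1 := image_invBranch_left ▸ ⟨hy.1, h⟩
      obtain ⟨z, hz, rfl⟩ := this
      rw [lanford_invBranch_left hz]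
    · right
      have : y ∈ invBranch 17 '' Ico 0 1 := image_invBranch_right ▸ ⟨h, hy.2⟩
      obtain ⟨z, hz, rfl⟩ := this
      rw [lanford_invBranch_right hz]
  · rintro (rfl | rfl)
    · exact ⟨⟨h1.1, h1.2.trans hb.2⟩, lanford_invBranch_left hx⟩
    · exact ⟨⟨hb.1.le.trans h2.1, h2.2⟩, lanford_invBranch_right hx⟩

theorem tsum_preimage_lanford (ρ : ℝ → ℝ) {x : ℝ} (hx : x ∈ Ico (0 : ℝ) 1) :
    ∑' y : {y : ℝ // y ∈ Ico (0 : ℝ) 1 ∧ lanford y = x}, ρ (y : ℝ) / (5 / 2 - (y : ℝ)) =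
      transferOp ρ x := by
  have h1 : invBranch 25 x ∈ Ico 0 breakPoint := image_invBranch_left ▸ mem_image_of_mem _ hx
  have h2 : invBranch 17 x ∈ Ico breakPoint 1 := image_invBranch_right ▸ mem_image_of_mem _ hx
  have hne : invBranch 25 x ≠ invBranch 17 x := (h1.2.trans_le h2.1).ne
  have h3 := tsum_congr_set_coe (fun y : ℝ => ρ y / (5 / 2 - y)) (preimage_lanford hx)
  refine h3.trans ?_
  have h4 : ({invBranch 25 x, invBranch 17 x} : Set ℝ) =
      (({invBranch 25 x, invBranch 17 x} : Finset ℝ) : Set ℝ) := by simp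
  rw [tsum_congr_set_coe (fun y : ℝ => ρ y / (5 / 2 - y)) h4,
    Finset.tsum_subtype' _ fun y : ℝ => ρ y / (5 / 2 - y), Finset.sum_pair hne]
  unfold transferOp
  rw [← inv_branchWeight, ← inv_branchWeight, div_inv_eq_mul, div_inv_eq_mul]

theorem injOn_invBranch {c : ℝ} (hc : 8 < c) : InjOn (invBranch c) (Ico 0 1) := by
  intro x hx y hy h
  unfold invBranch at h
  have h' : √(c - 8 * x) = √(c - 8 * y) := by linarith
  rw [Real.sqrt_inj (by linarith [hx.2]) (by linarith [hy.2])] at h'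
  linarith

theorem integrableOn_branch {c : ℝ} (hc : 8 < c) {F : ℝ → ℝ}
    (hF : IntegrableOn F (invBranch c '' Ico 0 1)) :
    IntegrableOn (fun x => F (invBranch c x) * branchWeight c x) (Ico 0 1) := by
  have h := (integrableOn_image_iff_integrableOn_abs_deriv_smul measurableSet_Ico
    (fun x hx => (hasDerivAt_invBranch (c := c) (by linarith [hx.2])).hasDerivWithinAt)
    (injOn_invBranch hc) F).1 hF
  refine h.congr_fun (fun x hx => ?_) measurableSet_Ico
  simp only [smul_eq_mul]
  rw [abs_of_pos (branchWeight_pos (by linarith [hx.2])), mul_comm]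

theorem integral_branch {c : ℝ} (hc : 8 < c) (F : ℝ → ℝ) :
    ∫ y in invBranch c '' Ico 0 1, F y =
      ∫ x in Ico 0 1, F (invBranch c x) * branchWeight c x := by
  rw [integral_image_eq_integral_abs_deriv_smul measurableSet_Ico
    (fun x hx => (hasDerivAt_invBranch (c := c) (by linarith [hx.2])).hasDerivWithinAt)
    (injOn_invBranch hc) F]
  refine setIntegral_congr_fun measurableSet_Ico (fun x hx => ?_)
  simp only [smul_eq_mul]
  rw [abs_of_pos (branchWeight_pos (by linarith [hx.2])), mul_comm]

theorem integrableOn_transferOp {φ : ℝ → ℝ} (hφ : IntegrableOn φ (Ico 0 1)) :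
    IntegrableOn (transferOp φ) (Ico 0 1) := by
  have hb := breakPoint_mem
  refine Integrable.add (integrableOn_branch (by norm_num) ?_)
    (integrableOn_branch (by norm_num) ?_)
  · rw [image_invBranch_left]
    exact hφ.mono_set (Ico_subset_Ico_right hb.2.le)
  · rw [image_invBranch_right]
    exact hφ.mono_set (Ico_subset_Ico_left hb.1.le)

theorem integrableOn_bdd_mul {h φ : ℝ → ℝ} {C : ℝ} {s : Set ℝ} (hm : Measurable h)
    (hC : ∀ x, |h x| ≤ C) (hφ : IntegrableOn φ s) : IntegrableOn (fun x => h x * φ x) s :=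
  Integrable.bdd_mul hφ hm.aestronglyMeasurable (Filter.Eventually.of_forall hC)

theorem integral_comp_lanford_mul {h φ : ℝ → ℝ} {C : ℝ} (hm : Measurable h)
    (hC : ∀ x, |h x| ≤ C) (hφ : IntegrableOn φ (Ico 0 1)) :
    ∫ y in Ico (0 : ℝ) 1, h (lanford y) * φ y = ∫ x in Ico (0 : ℝ) 1, h x * transferOp φ x := by
  have hb := breakPoint_mem
  have hI : IntegrableOn (fun y => h (lanford y) * φ y) (Ico 0 1) :=
    integrableOn_bdd_mul (hm.comp measurable_lanford) (fun x => hC _) hφ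
  have hI1 : IntegrableOn (fun y => h (lanford y) * φ y) (invBranch 25 '' Ico 0 1) := by
    rw [image_invBranch_left]
    exact hI.mono_set (Ico_subset_Ico_right hb.2.le)
  have hI2 : IntegrableOn (fun y => h (lanford y) * φ y) (invBranch 17 '' Ico 0 1) := by
    rw [image_invBranch_right]
    exact hI.mono_set (Ico_subset_Ico_left hb.1.le)
  have hU : Ico (0 : ℝ) 1 = invBranch 25 '' Ico 0 1 ∪ invBranch 17 '' Ico 0 1 := by
    rw [image_invBranch_left, image_invBranch_right, Ico_union_Ico_eq_Ico hb.1.le hb.2.le]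
  have hd : Disjoint (invBranch 25 '' Ico 0 1) (invBranch 17 '' Ico 0 1) := by
    rw [image_invBranch_left, image_invBranch_right]
    exact Ico_disjoint_Ico_same
  have hms : MeasurableSet (invBranch 17 '' Ico 0 1) := by
    rw [image_invBranch_right]
    exact measurableSet_Ico
  conv_lhs => rw [hU]
  rw [setIntegral_union hd hms hI1 hI2, integral_branch (by norm_num),
    integral_branch (by norm_num), ← integral_add (integrableOn_branch (by norm_num) hI1)
      (integrableOn_branch (by norm_num) hI2)]
  refine setIntegral_congr_fun measurableSet_Ico (fun x hx => ?_)
  simp only [transferOp]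
  rw [lanford_invBranch_left hx, lanford_invBranch_right hx]
  ring

/-- `φ` is differentiable on `[0, 1]`, with derivative bounded by `M`, and has mean zero. -/
structure MeanZeroC1 (φ : ℝ → ℝ) (M : ℝ) : Prop where
  deriv_le : ∀ x ∈ Icc (0 : ℝ) 1, ∃ d, HasDerivAt φ d x ∧ |d| ≤ M
  integral_eq : ∫ x in Ico (0 : ℝ) 1, φ x = 0

theorem MeanZeroC1.nonneg {φ : ℝ → ℝ} {M : ℝ} (h : MeanZeroC1 φ M) : 0 ≤ M := by
  obtain ⟨d, -, hd⟩ := h.deriv_le 0 (by simp)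
  exact (abs_nonneg d).trans hd

theorem integrableOn_of_deriv {φ : ℝ → ℝ} (h : ∀ x ∈ Icc (0 : ℝ) 1, ∃ d, HasDerivAt φ d x) :
    IntegrableOn φ (Ico 0 1) := by
  have hc : ContinuousOn φ (Icc 0 1) := fun x hx => by
    obtain ⟨d, hd⟩ := h x hx
    exact hd.continuousAt.continuousWithinAt
  exact hc.integrableOn_Icc.mono_set Ico_subset_Icc_self

theorem MeanZeroC1.integrableOn {φ : ℝ → ℝ} {M : ℝ} (h : MeanZeroC1 φ M) :
    IntegrableOn φ (Ico 0 1) :=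
  integrableOn_of_deriv fun x hx => (h.deriv_le x hx).imp fun _ hd => hd.1

theorem MeanZeroC1.abs_le {φ : ℝ → ℝ} {M : ℝ} (h : MeanZeroC1 φ M) {x : ℝ}
    (hx : x ∈ Icc (0 : ℝ) 1) : |φ x| ≤ M / 2 := by
  have hM := h.nonneg
  choose! φ' hφ' hb using h.deriv_le
  have hlip : ∀ y ∈ Icc (0 : ℝ) 1, |φ x - φ y| ≤ M * |x - y| := fun y hy =>
    Convex.norm_image_sub_le_of_norm_hasDerivWithin_le
      (fun z hz => (hφ' z hz).hasDerivWithinAt) hb (convex_Icc 0 1) hy hx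
  have hint : ∫ y in (0 : ℝ)..1, (φ x - φ y) = φ x := by
    have hi : IntervalIntegrable φ volume 0 1 := by
      rw [intervalIntegrable_iff_integrableOn_Ico_of_le zero_le_one]
      exact h.integrableOn
    rw [intervalIntegral.integral_sub (by simp) hi, intervalIntegral.integral_of_le zero_le_one,
      intervalIntegral.integral_of_le zero_le_one, ← integral_Ico_eq_integral_Ioc,
      ← integral_Ico_eq_integral_Ioc, h.integral_eq]
    simp
  have hcont : Continuous fun y : ℝ => M * |x - y| := by fun_prop
  have habs : ∫ y in (0 : ℝ)..1, M * |x - y| = M * ((x ^ 2 + (1 - x) ^ 2) / 2) := by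
    rw [intervalIntegral.integral_const_mul]
    congr 1
    have hc : Continuous fun y : ℝ => |x - y| := by fun_prop
    rw [← intervalIntegral.integral_add_adjacent_intervals (hc.intervalIntegrable 0 x)
      (hc.intervalIntegrable x 1)]
    have h1 : ∫ y in (0 : ℝ)..x, |x - y| = ∫ y in (0 : ℝ)..x, (x - y) := by
      refine intervalIntegral.integral_congr fun y hy => ?_
      rw [uIcc_of_le hx.1] at hy
      exact abs_of_nonneg (by linarith [hy.2])
    have h2 : ∫ y in x..1, |x - y| = ∫ y in x..1, (y - x) := by
      refine intervalIntegral.integral_congr fun y hy => ?_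
      rw [uIcc_of_le hx.2] at hy
      rw [abs_of_nonpos (by linarith [hy.1])]
      ring
    rw [h1, h2, intervalIntegral.integral_sub (by simp) (by simp),
      intervalIntegral.integral_sub (by simp) (by simp)]
    simp
    ring
  rw [← hint]
  calc |∫ y in (0 : ℝ)..1, (φ x - φ y)| ≤ ∫ y in (0 : ℝ)..1, M * |x - y| := by
        rw [← Real.norm_eq_abs]
        refine intervalIntegral.norm_integral_le_of_norm_le (μ := volume) zero_le_one ?_
          (hcont.intervalIntegrable 0 1)
        exact Filter.Eventually.of_forall fun y hy => hlip y (Ioc_subset_Icc_self hy)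
    _ = M * ((x ^ 2 + (1 - x) ^ 2) / 2) := habs
    _ ≤ M / 2 := by nlinarith [hx.1, hx.2, mul_nonneg hx.1 (sub_nonneg.2 hx.2)]

theorem hasDerivAt_branch {c x d : ℝ} {φ : ℝ → ℝ} (hx : 0 < c - 8 * x)
    (h : HasDerivAt φ d (invBranch c x)) :
    HasDerivAt (fun x => φ (invBranch c x) * branchWeight c x)
      (d * branchWeight c x ^ 2 + φ (invBranch c x) * branchWeight c x ^ 3) x := by
  refine ((h.comp x (hasDerivAt_invBranch hx)).mul (hasDerivAt_branchWeight hx)).congr_deriv ?_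
  simp only [Function.comp_apply]
  ring

theorem abs_branch_deriv_le {a b w E F u : ℝ} (ha : |a| ≤ E) (hb : |b| ≤ F) (hw : 0 ≤ w)
    (hu : w ≤ u) : |a * w ^ 2 + b * w ^ 3| ≤ E * u ^ 2 + F * u ^ 3 := by
  have hE : 0 ≤ E := (abs_nonneg a).trans ha
  have hF : 0 ≤ F := (abs_nonneg b).trans hb
  calc |a * w ^ 2 + b * w ^ 3| ≤ |a * w ^ 2| + |b * w ^ 3| := abs_add_le _ _
    _ = |a| * w ^ 2 + |b| * w ^ 3 := by
        rw [abs_mul, abs_mul, abs_of_nonneg (pow_nonneg hw 2), abs_of_nonneg (pow_nonneg hw 3)]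
    _ ≤ E * u ^ 2 + F * u ^ 3 := by gcongr

/-- A sum of one function on each branch, transported by the inverse branches, has a derivative
controlled by the functions and their derivatives. -/
theorem hasDerivAt_branch_sum {φ₁ φ₂ : ℝ → ℝ} {E F : ℝ}
    (h₁ : ∀ y ∈ Icc (0 : ℝ) (11 / 25), |φ₁ y| ≤ F ∧ ∃ d, HasDerivAt φ₁ d y ∧ |d| ≤ E)
    (h₂ : ∀ y ∈ Icc (7 / 16 : ℝ) 1, |φ₂ y| ≤ F ∧ ∃ d, HasDerivAt φ₂ d y ∧ |d| ≤ E)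
    {x : ℝ} (hx : x ∈ Icc (0 : ℝ) 1) :
    ∃ d, HasDerivAt (fun x => φ₁ (invBranch 25 x) * branchWeight 25 x +
      φ₂ (invBranch 17 x) * branchWeight 17 x) d x ∧ |d| ≤ 0.681 * E + 0.412 * F := by
  obtain ⟨hF₁, d₁, hd₁, hE₁⟩ := h₁ _ (invBranch_left_mem hx)
  obtain ⟨hF₂, d₂, hd₂, hE₂⟩ := h₂ _ (invBranch_right_mem hx)
  have hx₁ : 0 < 25 - 8 * x := by linarith [hx.2]
  have hx₂ : 0 < 17 - 8 * x := by linarith [hx.2]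
  refine ⟨_, (hasDerivAt_branch hx₁ hd₁).add (hasDerivAt_branch hx₂ hd₂), ?_⟩
  have hE : 0 ≤ E := (abs_nonneg _).trans hE₁
  have hF : 0 ≤ F := (abs_nonneg _).trans hF₁
  refine (abs_add_le _ _).trans ((add_le_add
    (abs_branch_deriv_le hE₁ hF₁ (branchWeight_pos hx₁).le (branchWeight_left_le hx.2))
    (abs_branch_deriv_le hE₂ hF₂ (branchWeight_pos hx₂).le
      (branchWeight_right_le hx.2))).trans ?_)
  norm_num
  linarith

theorem integral_transferOp {φ : ℝ → ℝ} (hφ : IntegrableOn φ (Ico 0 1)) :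
    ∫ x in Ico (0 : ℝ) 1, transferOp φ x = ∫ x in Ico (0 : ℝ) 1, φ x := by
  simpa using (integral_comp_lanford_mul (h := fun _ => 1) (C := 1) measurable_const
    (by simp) hφ).symm

theorem MeanZeroC1.transferOp {φ : ℝ → ℝ} {M : ℝ} (h : MeanZeroC1 φ M) :
    MeanZeroC1 (transferOp φ) (9 / 10 * M) where
  deriv_le x hx := by
    have hφ : ∀ y ∈ Icc (0 : ℝ) 1, |φ y| ≤ M / 2 ∧ ∃ d, HasDerivAt φ d y ∧ |d| ≤ M :=
      fun y hy => ⟨h.abs_le hy, h.deriv_le y hy⟩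
    obtain ⟨d, hd, hM⟩ := hasDerivAt_branch_sum
      (fun y hy => hφ y (Icc_subset_Icc_right (by norm_num) hy))
      (fun y hy => hφ y (Icc_subset_Icc_left (by norm_num) hy)) hx
    exact ⟨d, hd, hM.trans (by linarith [h.nonneg])⟩
  integral_eq := by rw [integral_transferOp h.integrableOn, h.integral_eq]

/-- Exponential decay of correlations for observables that are only bounded. -/
theorem MeanZeroC1.abs_integral_iterate_le {h : ℝ → ℝ} {C : ℝ} (hm : Measurable h)
    (hC : ∀ x, |h x| ≤ C) (n : ℕ) {φ : ℝ → ℝ} {M : ℝ} (hφ : MeanZeroC1 φ M) :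
    |∫ x in Ico (0 : ℝ) 1, h (lanford^[n] x) * φ x| ≤ C * M * (9 / 10) ^ n := by
  induction n generalizing φ M with
  | zero =>
    have hC0 : 0 ≤ C := (abs_nonneg _).trans (hC 0)
    have := norm_setIntegral_le_of_norm_le_const (μ := volume) (s := Ico (0 : ℝ) 1)
      (f := fun x => h x * φ x) (C := C * M) (by simp) (fun x hx => by
        rw [Real.norm_eq_abs, abs_mul]
        have := hφ.abs_le (Ico_subset_Icc_self hx)
        have h1 := hφ.nonneg
        exact mul_le_mul (hC x) (by linarith) (abs_nonneg _) hC0)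
    simpa using this
  | succ n ih =>
    have h1 : ∫ x in Ico (0 : ℝ) 1, h (lanford^[n + 1] x) * φ x =
        ∫ x in Ico (0 : ℝ) 1, h (lanford^[n] x) * _root_.transferOp φ x :=
      integral_comp_lanford_mul (h := fun x => h (lanford^[n] x))
        (hm.comp (measurable_lanford.iterate n)) (fun x => hC _) hφ.integrableOn
    rw [h1]
    refine (ih hφ.transferOp).trans_eq ?_
    ring

theorem exists_meanZeroC1_integral_sub_le {δ : ℝ → ℝ} (hδ : IntegrableOn δ (Ico 0 1))
    (hδ0 : ∫ x in Ico (0 : ℝ) 1, δ x = 0) {ε : ℝ} (hε : 0 < ε) :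
    ∃ φ M, MeanZeroC1 φ M ∧ ∫ x in Ico (0 : ℝ) 1, |δ x - φ x| ≤ ε := by
  obtain ⟨g, hgs, hg, hge⟩ := MemLp.exist_eLpNorm_sub_le ENNReal.one_ne_top le_rfl
    (memLp_one_iff_integrable.2 hδ) (half_pos hε)
  have hg1 : ContDiff ℝ 1 g := hg.of_le (by exact_mod_cast le_top)
  have hd : ∀ x, HasDerivAt g (deriv g x) x := fun x =>
    (hg1.differentiable (by norm_num) x).hasDerivAt
  have hgi : IntegrableOn g (Ico 0 1) := integrableOn_of_deriv fun x _ => ⟨_, hd x⟩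
  have hδg : IntegrableOn (fun x => |δ x - g x|) (Ico 0 1) := (hδ.sub hgi).abs
  have hsub : ∫ x in Ico (0 : ℝ) 1, |δ x - g x| ≤ ε / 2 := by
    rw [eLpNorm_one_eq_lintegral_enorm, ← ofReal_integral_norm_eq_lintegral_enorm (hδ.sub hgi),
      ENNReal.ofReal_le_ofReal_iff (half_pos hε).le] at hge
    exact hge
  set m := ∫ x in Ico (0 : ℝ) 1, g x with hm
  have hmle : |m| ≤ ε / 2 := by
    have h1 : ∫ x in Ico (0 : ℝ) 1, (δ x - g x) = -m := by
      rw [integral_sub hδ hgi, hδ0, zero_sub]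
    rw [← abs_neg, ← h1]
    exact (abs_integral_le_integral_abs).trans hsub
  obtain ⟨M, hM⟩ := isCompact_Icc.exists_bound_of_continuousOn (s := Icc (0 : ℝ) 1)
    (hg1.continuous_deriv le_rfl).continuousOn
  have hc : IntegrableOn (fun _ : ℝ => m) (Ico 0 1) := by simp
  refine ⟨fun x => g x - m, M, ⟨fun x hx => ⟨_, (hd x).sub_const m, hM x hx⟩, ?_⟩, ?_⟩
  · rw [integral_sub hgi hc]
    simp [← hm]
  · have h2 : ∫ x in Ico (0 : ℝ) 1, |δ x - (g x - m)| ≤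
        ∫ x in Ico (0 : ℝ) 1, (|δ x - g x| + ε / 2) := by
      refine integral_mono (hδ.sub (hgi.sub hc)).abs (hδg.add (by simp)) fun x => ?_
      have : δ x - (g x - m) = (δ x - g x) + m := by ring
      simp only [this]
      exact (abs_add_le _ _).trans (by gcongr)
    refine h2.trans ?_
    rw [integral_add hδg (by simp)]
    simp
    linarith

/-- A mean-zero function that the transfer operator fixes up to a residual `r` integrates
bounded observables to values controlled by the residual. -/
theorem abs_integral_mul_le_of_residual {h δ r : ℝ → ℝ} {C M : ℝ} (hm : Measurable h)
    (hC : ∀ x, |h x| ≤ C) (hδ : IntegrableOn δ (Ico 0 1))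
    (hδ0 : ∫ x in Ico (0 : ℝ) 1, δ x = 0) (hr : MeanZeroC1 r M)
    (heq : ∀ᵐ x ∂volume.restrict (Ico (0 : ℝ) 1), δ x = transferOp δ x + r x) :
    |∫ x in Ico (0 : ℝ) 1, h x * δ x| ≤ 10 * C * M := by
  have hC0 : 0 ≤ C := (abs_nonneg _).trans (hC 0)
  set J : ℕ → ℝ := fun n => ∫ x in Ico (0 : ℝ) 1, h (lanford^[n] x) * δ x with hJ
  have hmn : ∀ n, Measurable fun x => h (lanford^[n] x) := fun n =>
    hm.comp (measurable_lanford.iterate n)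
  have hstep : ∀ n, J n = J (n + 1) + ∫ x in Ico (0 : ℝ) 1, h (lanford^[n] x) * r x := fun n => by
    have h1 : J (n + 1) = ∫ x in Ico (0 : ℝ) 1, h (lanford^[n] x) * transferOp δ x :=
      integral_comp_lanford_mul (hmn n) (fun x => hC _) hδ
    rw [h1, ← integral_add
      (integrableOn_bdd_mul (hmn n) (fun x => hC _) (integrableOn_transferOp hδ))
      (integrableOn_bdd_mul (hmn n) (fun x => hC _) hr.integrableOn)]
    refine integral_congr_ae (heq.mono fun x hx => ?_)
    simp only
    rw [hx, mul_add]
  have hsum : ∀ n, |J 0| ≤ |J n| + 10 * C * M * (1 - (9 / 10) ^ n) := fun n => by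
    induction n with
    | zero => simp
    | succ n ih =>
      have h1 := hr.abs_integral_iterate_le hm hC n
      have h2 : |J n| ≤ |J (n + 1)| + C * M * (9 / 10) ^ n := by
        rw [hstep n]
        exact (abs_add_le _ _).trans (by gcongr)
      rw [pow_succ]
      linarith
  have hM0 := hr.nonneg
  refine le_of_forall_pos_le_add fun ε hε => ?_
  obtain ⟨φ, N, hφ, hφδ⟩ := exists_meanZeroC1_integral_sub_le hδ hδ0
    (show 0 < ε / (2 * (C + 1)) by positivity)
  have hN0 := hφ.nonneg
  obtain ⟨n, hn⟩ := exists_pow_lt_of_lt_one (show 0 < ε / (2 * (C * N + 1)) by positivity)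
    (show (9 / 10 : ℝ) < 1 by norm_num)
  have hδφ : IntegrableOn (fun x => h (lanford^[n] x) * (δ x - φ x)) (Ico 0 1) :=
    integrableOn_bdd_mul (hmn n) (fun x => hC _) (hδ.sub hφ.integrableOn)
  have hJn : |J n| ≤ ε := by
    have h1 : J n = (∫ x in Ico (0 : ℝ) 1, h (lanford^[n] x) * (δ x - φ x)) +
        ∫ x in Ico (0 : ℝ) 1, h (lanford^[n] x) * φ x := by
      rw [← integral_add hδφ
        (integrableOn_bdd_mul (hmn n) (fun x => hC _) hφ.integrableOn)]
      refine integral_congr_ae (Filter.Eventually.of_forall fun x => ?_)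
      simp only
      ring
    have h2 : |∫ x in Ico (0 : ℝ) 1, h (lanford^[n] x) * (δ x - φ x)| ≤ ε / 2 := by
      have h3 : |∫ x in Ico (0 : ℝ) 1, h (lanford^[n] x) * (δ x - φ x)| ≤
          ∫ x in Ico (0 : ℝ) 1, C * |δ x - φ x| := by
        refine abs_integral_le_integral_abs.trans (integral_mono
          hδφ.abs
          ((hδ.sub hφ.integrableOn).abs.const_mul C) fun x => ?_)
        simp only [abs_mul]
        gcongr
        exact hC _
      rw [integral_const_mul] at h3
      calc _ ≤ _ := h3
        _ ≤ C * (ε / (2 * (C + 1))) := by gcongr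
        _ ≤ (C + 1) * (ε / (2 * (C + 1))) := by gcongr; linarith
        _ = ε / 2 := by field_simp
    have h4 : |∫ x in Ico (0 : ℝ) 1, h (lanford^[n] x) * φ x| ≤ ε / 2 := by
      refine (hφ.abs_integral_iterate_le hm hC n).trans ?_
      calc C * N * (9 / 10) ^ n ≤ (C * N + 1) * (ε / (2 * (C * N + 1))) := by gcongr; linarith
        _ = ε / 2 := by field_simp
    rw [h1]
    exact (abs_add_le _ _).trans (by linarith)
  have h5 : |J 0| ≤ ε + 10 * C * M := by
    refine (hsum n).trans (add_le_add hJn ?_)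
    have : (0 : ℝ) ≤ (9 / 10) ^ n := by positivity
    have h6 : 0 ≤ 10 * C * M := by positivity
    nlinarith
  simpa [hJ, add_comm] using h5

theorem abs_integral_sub_le_of_residual {h ρ p : ℝ → ℝ} {C M : ℝ} (hm : Measurable h)
    (hC : ∀ x, |h x| ≤ C) (hρ : IntegrableOn ρ (Ico 0 1)) (hp : IntegrableOn p (Ico 0 1))
    (hint : ∫ x in Ico (0 : ℝ) 1, ρ x = ∫ x in Ico (0 : ℝ) 1, p x)
    (heq : ∀ᵐ x ∂volume.restrict (Ico (0 : ℝ) 1), ρ x = transferOp ρ x)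
    (hr : ∀ x ∈ Icc (0 : ℝ) 1, ∃ d, HasDerivAt (fun x => transferOp p x - p x) d x ∧ |d| ≤ M) :
    |(∫ x in Ico (0 : ℝ) 1, h x * ρ x) - ∫ x in Ico (0 : ℝ) 1, h x * p x| ≤ 10 * C * M := by
  rw [← integral_sub (integrableOn_bdd_mul hm hC hρ) (integrableOn_bdd_mul hm hC hp)]
  simp only [← mul_sub]
  refine abs_integral_mul_le_of_residual hm hC (hρ.sub hp) ?_ ⟨hr, ?_⟩ ?_
  · rw [integral_sub hρ hp, hint, sub_self]
  · rw [integral_sub (integrableOn_transferOp hp) hp, integral_transferOp hp, sub_self]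
  · filter_upwards [heq] with x hx
    rw [hx]
    simp only [transferOp]
    ring

/-- The density on `[0, 1]` of an approximate distribution function given by Taylor coefficients
in `2 * x - 1`. -/
noncomputable def polyDensity (l : List ℤ) (x : ℝ) : ℝ :=
  2 * homEval (derivCoeffs l) (2 * x - 1) 1 / 10 ^ 148

theorem hasDerivAt_homEval_comp (l : List ℤ) {u : ℝ → ℝ} {u' x : ℝ} (hu : HasDerivAt u u' x) :
    HasDerivAt (fun x => homEval l (u x) 1) (homEval (derivCoeffs l) (u x) 1 * u') x :=
  (hasDerivAt_homEval l (u x)).comp x hu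

theorem hasDerivAt_affine (a b x : ℝ) : HasDerivAt (fun x : ℝ => a * x - b) a x := by
  simpa using ((hasDerivAt_id x).const_mul a).sub_const b

theorem hasDerivAt_polyDensity (l : List ℤ) (x : ℝ) :
    HasDerivAt (polyDensity l)
      (2 * (homEval (derivCoeffs (derivCoeffs l)) (2 * x - 1) 1 * 2) / 10 ^ 148) x :=
  ((hasDerivAt_homEval_comp _ (hasDerivAt_affine 2 1 x)).const_mul 2).div_const _

theorem continuous_polyDensity (l : List ℤ) : Continuous (polyDensity l) :=
  continuous_iff_continuousAt.2 fun x => (hasDerivAt_polyDensity l x).continuousAt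

theorem hasDerivAt_homEval_affine (l : List ℤ) (x : ℝ) :
    HasDerivAt (fun x : ℝ => homEval l (2 * x - 1) 1) (10 ^ 148 * polyDensity l x) x := by
  refine (hasDerivAt_homEval_comp l (hasDerivAt_affine 2 1 x)).congr_deriv ?_
  unfold polyDensity
  field_simp

theorem polyDensity_cdfCoeffs (x : ℝ) :
    polyDensity cdfCoeffs x = polyDensity leftCoeffs x + polyDensity rightCoeffs x := by
  have h1 := hasDerivAt_homEval_affine cdfCoeffs x
  have h2 := (hasDerivAt_homEval_affine leftCoeffs x).add (hasDerivAt_homEval_affine rightCoeffs x)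
  have h3 : (fun x : ℝ => homEval cdfCoeffs (2 * x - 1) 1) =
      (fun x : ℝ => homEval leftCoeffs (2 * x - 1) 1) +
        fun x : ℝ => homEval rightCoeffs (2 * x - 1) 1 := by
    funext y
    exact (homEval_addCoeffs _ _ (length_coeffs.2.1.trans length_coeffs.2.2.symm) _ _).1
  rw [h3] at h1
  have h4 := h1.unique h2
  rw [← mul_add] at h4
  exact mul_left_cancel₀ (by positivity) h4

/-- The defect of the fixed point equation pulled back to the branch whose image is shifted
by `e`. -/
noncomputable def branchDefect (l : List ℤ) (e v : ℝ) : ℝ :=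
  polyDensity l ((5 * v - v ^ 2) / 2 - e) * (5 / 2 - v) - polyDensity cdfCoeffs v

theorem branchDefect_eq {l D : List ℤ} {e a b S : ℝ} (hS : S ≠ 0) (hl : l.length = 310)
    (h : ∀ v : ℝ, homEval D (a * v - b) 1 = homEval cdfCoeffs (S * (2 * v - 1)) S -
      homEval l (S * (5 * v - v ^ 2 - 1 - 2 * e)) S) (v : ℝ) :
    branchDefect l e v = -(homEval (derivCoeffs D) (a * v - b) 1 * a / (10 ^ 148 * S ^ 309)) := by
  have h1 : ∀ v : ℝ, homEval D (a * v - b) 1 = S ^ 309 * (homEval cdfCoeffs (2 * v - 1) 1 -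
      homEval l (2 * ((5 * v - v ^ 2) / 2 - e) - 1) 1) := fun v => by
    have h2 := homEval_scale cdfCoeffs (2 * v - 1) S
    have h3 := homEval_scale l (5 * v - v ^ 2 - 1 - 2 * e) S
    rw [length_coeffs.1] at h2
    rw [hl] at h3
    rw [show 2 * ((5 * v - v ^ 2) / 2 - e) - 1 = 5 * v - v ^ 2 - 1 - 2 * e by ring]
    refine mul_left_cancel₀ hS ?_
    rw [h, mul_sub, h2, h3]
    ring
  have hu : HasDerivAt (fun v : ℝ => (5 * v - v ^ 2) / 2 - e) (5 / 2 - v) v := by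
    refine (((((hasDerivAt_id v).const_mul 5).sub (hasDerivAt_pow 2 v)).div_const 2).sub_const
      e).congr_deriv ?_
    norm_num
    ring
  have h4 := ((hasDerivAt_homEval_affine cdfCoeffs v).sub
    ((hasDerivAt_homEval_affine l ((5 * v - v ^ 2) / 2 - e)).comp v hu)).const_mul (S ^ 309)
  have h5 := hasDerivAt_homEval_comp D (hasDerivAt_affine a b v)
  have h6 := h5.unique (h4.congr_of_eventuallyEq (Filter.Eventually.of_forall h1))
  rw [h6]
  unfold branchDefect
  field_simp
  ring

theorem abs_branchDefect_le {l D : List ℤ} {e a b S : ℝ} {s : Set ℝ} (hS : 0 < S) (ha : 0 < a)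
    (hE : ∀ v, branchDefect l e v =
      -(homEval (derivCoeffs D) (a * v - b) 1 * a / (10 ^ 148 * S ^ 309)))
    (hs : ∀ v ∈ s, |a * v - b| ≤ 1)
    (h1 : absSum (derivCoeffs D) * a * 10 ^ 132 ≤ 10 ^ 148 * S ^ 309)
    (h2 : absSum (derivCoeffs (derivCoeffs D)) * a ^ 2 * 10 ^ 132 ≤ 10 ^ 148 * S ^ 309) :
    ∀ v ∈ s, |branchDefect l e v| ≤ 1 / 10 ^ 132 ∧
      ∃ d, HasDerivAt (branchDefect l e) d v ∧ |d| ≤ 1 / 10 ^ 132 := by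
  intro v hv
  have hK : 0 < 10 ^ 148 * S ^ 309 := by positivity
  refine ⟨?_, _, (((hasDerivAt_homEval_comp (derivCoeffs D) (hasDerivAt_affine a b v)).mul_const
    a).div_const (10 ^ 148 * S ^ 309)).neg.congr_of_eventuallyEq
    (Filter.Eventually.of_forall hE), ?_⟩
  · rw [hE, abs_neg, abs_div, abs_of_pos hK, div_le_div_iff₀ hK (by positivity), one_mul, abs_mul,
      abs_of_pos ha]
    refine le_trans ?_ h1
    gcongr
    exact abs_homEval_le _ (hs v hv)
  · rw [abs_neg, abs_div, abs_of_pos hK, div_le_div_iff₀ hK (by positivity), one_mul, mul_assoc,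
      ← sq, abs_mul, abs_of_pos (pow_pos ha 2)]
    refine le_trans ?_ h2
    gcongr
    exact abs_homEval_le _ (hs v hv)

set_option exponentiation.threshold 500 in
theorem abs_leftBranchDefect_le : ∀ v ∈ Icc (0 : ℝ) (11 / 25),
    |branchDefect leftCoeffs 0 v| ≤ 1 / 10 ^ 132 ∧
      ∃ d, HasDerivAt (branchDefect leftCoeffs 0) d v ∧ |d| ≤ 1 / 10 ^ 132 := by
  refine abs_branchDefect_le (D := leftDigits) (a := 50 / 11) (b := 1) (S := 2500)
    (by norm_num) (by norm_num)
    (branchDefect_eq (by norm_num) length_coeffs.2.1 fun v => ?_) (fun v hv => ?_) ?_ ?_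
  · rw [← leftDefect_eq, leftDefect]
    congr 2 <;> ring
  · rw [abs_le]
    constructor <;> linarith [hv.1, hv.2]
  · have h : ((absSum (derivCoeffs leftDigits) * 50 * 10 ^ 132 : ℤ) : ℝ) ≤
      ((11 * (10 ^ 148 * 2500 ^ 309) : ℤ) : ℝ) := Int.cast_le.2 absSum_derivCoeffs_leftDigits_le
    push_cast at h
    linarith
  · have h : ((absSum (derivCoeffs (derivCoeffs leftDigits)) * 2500 * 10 ^ 132 : ℤ) : ℝ) ≤
      ((121 * (10 ^ 148 * 2500 ^ 309) : ℤ) : ℝ) :=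
      Int.cast_le.2 absSum_derivCoeffs_derivCoeffs_leftDigits_le
    push_cast at h
    linarith

set_option exponentiation.threshold 500 in
theorem abs_rightBranchDefect_le : ∀ v ∈ Icc (7 / 16 : ℝ) 1,
    |branchDefect rightCoeffs 1 v| ≤ 1 / 10 ^ 132 ∧
      ∃ d, HasDerivAt (branchDefect rightCoeffs 1) d v ∧ |d| ≤ 1 / 10 ^ 132 := by
  refine abs_branchDefect_le (D := rightDigits) (a := 32 / 9) (b := 23 / 9) (S := 1024)
    (by norm_num) (by norm_num)
    (branchDefect_eq (by norm_num) length_coeffs.2.2 fun v => ?_) (fun v hv => ?_) ?_ ?_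
  · rw [← rightDefect_eq, rightDefect]
    congr 2 <;> ring
  · rw [abs_le]
    constructor <;> linarith [hv.1, hv.2]
  · have h : ((absSum (derivCoeffs rightDigits) * 32 * 10 ^ 132 : ℤ) : ℝ) ≤
      ((9 * (10 ^ 148 * 1024 ^ 309) : ℤ) : ℝ) := Int.cast_le.2 absSum_derivCoeffs_rightDigits_le
    push_cast at h
    linarith
  · have h : ((absSum (derivCoeffs (derivCoeffs rightDigits)) * 1024 * 10 ^ 132 : ℤ) : ℝ) ≤
      ((81 * (10 ^ 148 * 1024 ^ 309) : ℤ) : ℝ) :=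
      Int.cast_le.2 absSum_derivCoeffs_derivCoeffs_rightDigits_le
    push_cast at h
    linarith

theorem branchDefect_invBranch (l : List ℤ) {c x : ℝ} (hx : 0 < c - 8 * x) :
    branchDefect l ((25 - c) / 8) (invBranch c x) * branchWeight c x =
      polyDensity l x - polyDensity cdfCoeffs (invBranch c x) * branchWeight c x := by
  have h1 : invBranch c x ≤ 5 / 2 := by
    unfold invBranch
    linarith [Real.sqrt_nonneg (c - 8 * x)]
  have h2 := (invBranch_eq_iff hx.le h1).1 rfl
  have h3 := (branchWeight_pos hx).ne'
  unfold branchDefect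
  rw [h2, add_sub_cancel_right, ← inv_branchWeight]
  field_simp

theorem residual_deriv_le {x : ℝ} (hx : x ∈ Icc (0 : ℝ) 1) :
    ∃ d, HasDerivAt (fun x => transferOp (polyDensity cdfCoeffs) x - polyDensity cdfCoeffs x) d x ∧
      |d| ≤ 2 / 10 ^ 132 := by
  obtain ⟨d, hd, hle⟩ := hasDerivAt_branch_sum abs_leftBranchDefect_le abs_rightBranchDefect_le hx
  refine ⟨-d, hd.neg.congr_of_eventuallyEq ?_, ?_⟩
  · filter_upwards [Iio_mem_nhds (show x < 2 by linarith [hx.2])] with y hy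
    rw [mem_Iio] at hy
    have h1 := branchDefect_invBranch leftCoeffs (c := 25) (x := y) (by linarith)
    have h2 := branchDefect_invBranch rightCoeffs (c := 17) (x := y) (by linarith)
    norm_num only at h1 h2
    simp only [Pi.neg_apply, h1, h2, transferOp, polyDensity_cdfCoeffs y]
    ring
  · rw [abs_neg]
    refine hle.trans ?_
    have : (0 : ℝ) < 1 / 10 ^ 132 := by positivity
    rw [show (2 : ℝ) / 10 ^ 132 = 2 * (1 / 10 ^ 132) by ring]
    linarith

theorem continuous_homEval (l : List ℤ) : Continuous fun s : ℝ => homEval l s 1 :=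
  continuous_iff_continuousAt.2 fun s => (hasDerivAt_homEval l s).continuousAt

theorem continuous_homEval_affine (l : List ℤ) : Continuous fun x : ℝ => homEval l (2 * x - 1) 1 :=
  (continuous_homEval l).comp (by fun_prop)

theorem abs_intCast_div_sub_floor_le (a b : ℤ) (hb : 0 < b) :
    |(a : ℝ) / b - ((a / b : ℤ) : ℝ)| ≤ 1 := by
  have hb' : (0 : ℝ) < b := by exact_mod_cast hb
  have h0 : (0 : ℝ) ≤ (a % b : ℤ) := by exact_mod_cast Int.emod_nonneg a hb.ne'
  have h1 : ((a % b : ℤ) : ℝ) ≤ b := by exact_mod_cast (Int.emod_lt_of_pos a hb).le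
  have h2 : ((a % b : ℤ) : ℝ) + b * (a / b : ℤ) = a := by exact_mod_cast Int.emod_add_mul_ediv a b
  have h3 : (a : ℝ) / b - ((a / b : ℤ) : ℝ) = (a % b : ℤ) / b := by
    rw [← h2]
    field_simp
    ring
  rw [h3, abs_of_nonneg (div_nonneg h0 hb'.le)]
  exact div_le_one_of_le₀ h1 hb'.le

theorem integral_affine_pow (k : ℕ) :
    ∫ x in (0 : ℝ)..1, (2 * x - 1) ^ k = if k % 2 = 0 then 1 / ((k : ℝ) + 1) else 0 := by
  have h := intervalIntegral.mul_integral_comp_mul_sub (f := fun t : ℝ => t ^ k) (a := 0) (b := 1)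
    (c := 2) (d := 1)
  rw [integral_pow] at h
  split_ifs with hk
  · have : Odd (k + 1) := (Nat.even_iff.2 hk).add_one
    norm_num [this.neg_one_pow] at h
    field_simp at h ⊢
    linarith
  · have : Even (k + 1) := (Nat.odd_iff.2 (by omega)).add_one
    norm_num [this.neg_one_pow] at h
    exact h

theorem abs_integral_sub_momentSum_le (k : ℕ) (l : List ℤ) :
    |(∫ x in (0 : ℝ)..1, (2 * x - 1) ^ k * homEval l (2 * x - 1) 1) - momentSum k l| ≤
      l.length := by
  induction l generalizing k with
  | nil => simp [homEval, momentSum]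
  | cons a l ih =>
    have hc := continuous_homEval_affine l
    have h1 : ∫ x in (0 : ℝ)..1, (2 * x - 1) ^ k * homEval (a :: l) (2 * x - 1) 1 =
        a * (∫ x in (0 : ℝ)..1, (2 * x - 1) ^ k) +
          ∫ x in (0 : ℝ)..1, (2 * x - 1) ^ (k + 1) * homEval l (2 * x - 1) 1 := by
      rw [← intervalIntegral.integral_const_mul, ← intervalIntegral.integral_add
        (Continuous.intervalIntegrable (by fun_prop) _ _)
        (Continuous.intervalIntegrable (by fun_prop) _ _)]
      refine intervalIntegral.integral_congr fun x _ => ?_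
      simp only [homEval, one_pow, mul_one]
      ring
    have h2 : |(a : ℝ) * (if k % 2 = 0 then 1 / ((k : ℝ) + 1) else 0) -
        ((if k % 2 = 0 then a / (k + 1 : ℤ) else 0 : ℤ) : ℝ)| ≤ 1 := by
      split_ifs
      · have h := abs_intCast_div_sub_floor_le a (k + 1) (by positivity)
        push_cast at h ⊢
        rwa [mul_one_div]
      · simp
    rw [h1, integral_affine_pow, momentSum]
    push_cast [List.length_cons]
    have h3 := abs_add_le ((a : ℝ) * (if k % 2 = 0 then 1 / ((k : ℝ) + 1) else 0) -
        ((if k % 2 = 0 then a / (k + 1 : ℤ) else 0 : ℤ) : ℝ))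
      ((∫ x in (0 : ℝ)..1, (2 * x - 1) ^ (k + 1) * homEval l (2 * x - 1) 1) - momentSum (k + 1) l)
    have h4 := ih (k + 1)
    push_cast at h3 h2
    refine (le_of_eq ?_).trans (h3.trans (by linarith))
    congr 1
    ring

theorem abs_sum_sub_logSum_le (N a b : ℤ) (hb : 0 < b) (n : ℕ) :
    |(N : ℝ) * (∑ i ∈ Finset.range n, ((a : ℝ) / b) ^ (i + 1) / (i + 1)) - logSum N a b n| ≤ n := by
  induction n with
  | zero => simp [logSum]
  | succ n ih =>
    have h := abs_intCast_div_sub_floor_le (N * a ^ (n + 1)) (b ^ (n + 1) * (n + 1))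
      (by positivity)
    rw [Finset.sum_range_succ, logSum]
    have h3 := (abs_add_le _ _).trans (add_le_add ih h)
    push_cast at h3 ⊢
    refine (le_of_eq ?_).trans h3
    rw [mul_add, div_pow, div_div, mul_div_assoc]
    congr 1
    ring

theorem abs_mul_log_add_logSum_le (N a b : ℤ) (ha : 0 ≤ a) (hab : a < b) (hN : 0 ≤ N) (n : ℕ) :
    |(N : ℝ) * -Real.log (1 - a / b) - logSum N a b n| ≤
      n + N * (((a : ℝ) / b) ^ (n + 1) / (1 - a / b)) := by
  have hb : (0 : ℝ) < b := by exact_mod_cast ha.trans_lt hab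
  have hx0 : 0 ≤ (a : ℝ) / b := div_nonneg (by exact_mod_cast ha) hb.le
  have hx : |(a : ℝ) / b| < 1 := by
    rw [abs_of_nonneg hx0, div_lt_one hb]
    exact_mod_cast hab
  have h1 := Real.abs_log_sub_add_sum_range_le hx n
  rw [abs_of_nonneg hx0] at h1
  have h2 := abs_sum_sub_logSum_le N a b (ha.trans_lt hab) n
  set s := ∑ i ∈ Finset.range n, ((a : ℝ) / b) ^ (i + 1) / (i + 1)
  have h3 : (N : ℝ) * -Real.log (1 - a / b) - logSum N a b n =
      (N * s - logSum N a b n) - N * (s + Real.log (1 - a / b)) := by ring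
  rw [h3]
  refine (abs_sub _ _).trans (add_le_add h2 ?_)
  rw [abs_mul, abs_of_nonneg (show (0 : ℝ) ≤ N by exact_mod_cast hN)]
  gcongr

set_option exponentiation.threshold 500 in
theorem abs_log_three_halves_sub_le :
    |(10 : ℝ) ^ 190 * Real.log (3 / 2) - logSum (10 ^ 190) 1 3 480| ≤ 481 := by
  have h := abs_mul_log_add_logSum_le (10 ^ 190) 1 3 (by norm_num) (by norm_num) (by norm_num) 480
  rw [← Real.log_inv] at h
  push_cast at h
  norm_num only at h ⊢
  exact h.trans (by norm_num)

set_option exponentiation.threshold 500 in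
theorem abs_log_five_thirds_sub_le :
    |(10 : ℝ) ^ 190 * Real.log (5 / 3) - logSum (10 ^ 190) 2 5 480| ≤ 481 := by
  have h := abs_mul_log_add_logSum_le (10 ^ 190) 2 5 (by norm_num) (by norm_num) (by norm_num) 480
  rw [← Real.log_inv] at h
  push_cast at h
  norm_num only at h ⊢
  exact h.trans (by norm_num)

theorem integral_log_mul_polyDensity (l : List ℤ) :
    10 ^ 148 * ∫ x in (0 : ℝ)..1, Real.log (5 / 2 - x) * polyDensity l x =
      Real.log (3 / 2) * ((homEval l (1 : ℤ) 1 - homEval l (4 : ℤ) 1 : ℤ) : ℝ) -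
        Real.log (5 / 2) * ((homEval l (-1 : ℤ) 1 - homEval l (4 : ℤ) 1 : ℤ) : ℝ) -
          2 * ∫ x in (0 : ℝ)..1, homEval (quotFour l) (2 * x - 1) 1 := by
  set Q : ℝ → ℝ := fun x => homEval (quotFour l) (2 * x - 1) 1
  have hQ : Continuous Q := continuous_homEval_affine _
  have hderiv : ∀ x ∈ uIcc (0 : ℝ) 1, HasDerivAt (fun x : ℝ => Real.log (5 / 2 - x) *
      (homEval l (2 * x - 1) 1 - ((homEval l (4 : ℤ) 1 : ℤ) : ℝ)))
      (10 ^ 148 * (Real.log (5 / 2 - x) * polyDensity l x) + 2 * Q x) x := fun x hx => by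
    rw [uIcc_of_le zero_le_one] at hx
    have hne : 5 / 2 - x ≠ 0 := by linarith [hx.2]
    have h1 := (((hasDerivAt_id x).const_sub (5 / 2)).log hne).mul
      ((hasDerivAt_homEval_affine l x).sub_const ((homEval l (4 : ℤ) 1 : ℤ) : ℝ))
    refine h1.congr_deriv ?_
    simp only [id]
    have h2 : homEval l (2 * x - 1) 1 - ((homEval l (4 : ℤ) 1 : ℤ) : ℝ) =
        -2 * (5 / 2 - x) * Q x := by
      rw [homEval_quotFour l (2 * x - 1)]
      ring
    have h3 : -1 / (5 / 2 - x) * (-2 * (5 / 2 - x) * Q x) = 2 * Q x := by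
      generalize 5 / 2 - x = u at hne ⊢
      field_simp
    rw [h2, h3]
    ring
  have hlog : ContinuousOn (fun x : ℝ => Real.log (5 / 2 - x)) (uIcc 0 1) := by
    rw [uIcc_of_le zero_le_one]
    exact ContinuousOn.log (by fun_prop) fun x hx => by linarith [hx.2]
  have hi : IntervalIntegrable (fun x => Real.log (5 / 2 - x) * polyDensity l x) volume 0 1 :=
    (hlog.mul (continuous_polyDensity l).continuousOn).intervalIntegrable
  have hftc := intervalIntegral.integral_eq_sub_of_hasDerivAt hderiv
    ((hi.const_mul _).add ((hQ.intervalIntegrable 0 1).const_mul 2))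
  rw [intervalIntegral.integral_add (hi.const_mul _) ((hQ.intervalIntegrable 0 1).const_mul 2),
    intervalIntegral.integral_const_mul, intervalIntegral.integral_const_mul] at hftc
  have h1 : (homEval l (1 : ℝ) 1) = ((homEval l (1 : ℤ) 1 : ℤ) : ℝ) := by
    simpa using (map_homEval (Int.castRingHom ℝ) l 1 1).symm
  have h2 : (homEval l (-1 : ℝ) 1) = ((homEval l (-1 : ℤ) 1 : ℤ) : ℝ) := by
    simpa using (map_homEval (Int.castRingHom ℝ) l (-1) 1).symm
  norm_num only [h1, h2] at hftc
  push_cast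
  linarith

theorem integral_polyDensity : ∫ x in (0 : ℝ)..1, polyDensity cdfCoeffs x = 1 := by
  have hftc := intervalIntegral.integral_eq_sub_of_hasDerivAt
    (fun x _ => hasDerivAt_homEval_affine cdfCoeffs x)
    (((continuous_polyDensity cdfCoeffs).const_mul _).intervalIntegrable 0 1)
  have h1 : (homEval cdfCoeffs (1 : ℝ) 1) = ((homEval cdfCoeffs (1 : ℤ) 1 : ℤ) : ℝ) := by
    simpa using (map_homEval (Int.castRingHom ℝ) cdfCoeffs 1 1).symm
  have h2 : (homEval cdfCoeffs (-1 : ℝ) 1) = ((homEval cdfCoeffs (-1 : ℤ) 1 : ℤ) : ℝ) := by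
    simpa using (map_homEval (Int.castRingHom ℝ) cdfCoeffs (-1) 1).symm
  rw [intervalIntegral.integral_const_mul, show (2 : ℝ) * 1 - 1 = 1 by norm_num,
    show (2 : ℝ) * 0 - 1 = -1 by norm_num, h1, h2, ← Int.cast_sub,
    homEval_cdfCoeffs_one_sub] at hftc
  push_cast at hftc
  linarith

set_option exponentiation.threshold 500 in
theorem abs_integral_log_mul_polyDensity_sub_le :
    |(∫ x in (0 : ℝ)..1, Real.log (5 / 2 - x) * polyDensity cdfCoeffs x) -
        0.65766178000659767754158241382383206574324106958001220195395280269163266611155402375955645975291517482964215633179802630148859489| ≤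
      1 / 10 ^ 128 + 1 / 10 ^ 140 := by
  have hs := abs_lyapunovSum_sub_le
  obtain ⟨ha, hb⟩ := abs_homEval_cdfCoeffs_sub_le
  have hI := integral_log_mul_polyDensity cdfCoeffs
  set V := ∫ x in (0 : ℝ)..1, Real.log (5 / 2 - x) * polyDensity cdfCoeffs x
  have hM := abs_integral_sub_momentSum_le 0 (quotFour cdfCoeffs)
  simp only [pow_zero, one_mul, length_quotFour_cdfCoeffs] at hM
  set K := ∫ x in (0 : ℝ)..1, homEval (quotFour cdfCoeffs) (2 * x - 1) 1
  have h52 : Real.log (5 / 2) = Real.log (3 / 2) + Real.log (5 / 3) := by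
    rw [← Real.log_mul (by norm_num) (by norm_num)]
    norm_num
  have h1 := abs_log_three_halves_sub_le
  have h2 := abs_log_five_thirds_sub_le
  rw [h52] at hI
  rw [lyapunovSum] at hs
  generalize homEval cdfCoeffs (1 : ℤ) 1 - homEval cdfCoeffs (4 : ℤ) 1 = A at *
  generalize homEval cdfCoeffs (-1 : ℤ) 1 - homEval cdfCoeffs (4 : ℤ) 1 = B at *
  generalize momentSum 0 (quotFour cdfCoeffs) = m at *
  generalize logSum (10 ^ 190) 1 3 480 = p at *
  generalize logSum (10 ^ 190) 2 5 480 = q at *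
  generalize Real.log (3 / 2) = u at *
  generalize Real.log (5 / 3) = v at *
  have ha' : |(A : ℝ)| ≤ 10 ^ 186 := by exact_mod_cast ha
  have hb' : |(B : ℝ)| ≤ 10 ^ 186 := by exact_mod_cast hb
  have hs' : |(10 : ℝ) ^ 128 * (p * A - (p + q) * B - 2 * 10 ^ 190 * m) -
      65766178000659767754158241382383206574324106958001220195395280269163266611155402375955645975291517482964215633179802630148859489 *
        10 ^ 338| ≤ 10 ^ 338 := by exact_mod_cast hs
  have e1 : |(10 ^ 190 * u - p) * (A : ℝ)| ≤ 481 * 10 ^ 186 := by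
    rw [abs_mul]
    exact mul_le_mul h1 ha' (abs_nonneg _) (by norm_num)
  have e2 : |(10 ^ 190 * u - p) * (B : ℝ)| ≤ 481 * 10 ^ 186 := by
    rw [abs_mul]
    exact mul_le_mul h1 hb' (abs_nonneg _) (by norm_num)
  have e3 : |(10 ^ 190 * v - q) * (B : ℝ)| ≤ 481 * 10 ^ 186 := by
    rw [abs_mul]
    exact mul_le_mul h2 hb' (abs_nonneg _) (by norm_num)
  have key : (10 : ℝ) ^ 338 * V - (p * A - (p + q) * B - 2 * 10 ^ 190 * m) =
      (10 ^ 190 * u - p) * A - (10 ^ 190 * u - p) * B - (10 ^ 190 * v - q) * B -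
        2 * 10 ^ 190 * (K - m) := by
    linear_combination (10 : ℝ) ^ 190 * hI
  generalize (p : ℝ) * A - (p + q) * B - 2 * 10 ^ 190 * m = S at *
  generalize (10 ^ 190 * u - p) * (A : ℝ) = x₁ at *
  generalize (10 ^ 190 * u - p) * (B : ℝ) = x₂ at *
  generalize (10 ^ 190 * v - q) * (B : ℝ) = x₃ at *
  push_cast at hM
  rw [abs_le] at *
  constructor
  · linarith [key, hs'.1, hs'.2, e1.1, e1.2, e2.1, e2.2, e3.1, e3.2, hM.1, hM.2]
  · linarith [key, hs'.1, hs'.2, e1.1, e1.2, e2.1, e2.2, e3.1, e3.2, hM.1, hM.2]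

theorem intervalIntegral_zero_one_eq (g : ℝ → ℝ) :
    ∫ x in (0 : ℝ)..1, g x = ∫ x in Ico (0 : ℝ) 1, g x := by
  rw [intervalIntegral.integral_of_le zero_le_one, integral_Ico_eq_integral_Ioc]

theorem abs_log_five_halves_sub_le_one {x : ℝ} (hx : x ∈ Icc (0 : ℝ) 1) :
    |Real.log (5 / 2 - x)| ≤ 1 := by
  have h0 : 0 ≤ Real.log (5 / 2 - x) := Real.log_nonneg (by linarith [hx.2])
  rw [abs_of_nonneg h0, Real.log_le_iff_le_exp (by linarith [hx.2])]
  linarith [hx.1, Real.exp_one_gt_d9]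

theorem abs_lyapunov_sub_le {ρ : ℝ → ℝ} (hint : ∫ x in (0 : ℝ)..1, ρ x = 1)
    (htransfer : ∀ᵐ x ∂volume.restrict (Ico (0 : ℝ) 1), ρ x = transferOp ρ x) :
    |(∫ x in (0 : ℝ)..1, Real.log (5 / 2 - x) * ρ x) -
      ∫ x in (0 : ℝ)..1, Real.log (5 / 2 - x) * polyDensity cdfCoeffs x| ≤
      10 * 1 * (2 / 10 ^ 132) := by
  have hρ : IntegrableOn ρ (Ico (0 : ℝ) 1) := by
    rw [intervalIntegral_zero_one_eq] at hint
    by_contra h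
    rw [integral_undef h] at hint
    exact zero_ne_one hint
  have hp : IntegrableOn (polyDensity cdfCoeffs) (Ico (0 : ℝ) 1) :=
    ((continuous_polyDensity cdfCoeffs).integrableOn_Icc (a := 0) (b := 1)).mono_set
      Ico_subset_Icc_self
  have hlog : ∀ g : ℝ → ℝ, ∫ x in (0 : ℝ)..1, Real.log (5 / 2 - x) * g x =
      ∫ x in Ico (0 : ℝ) 1, (Icc (0 : ℝ) 1).indicator (fun x => Real.log (5 / 2 - x)) x * g x :=
    fun g => by
      rw [intervalIntegral_zero_one_eq]
      refine setIntegral_congr_fun measurableSet_Ico fun x hx => ?_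
      simp only [indicator_of_mem (Ico_subset_Icc_self hx)]
  rw [hlog, hlog]
  refine abs_integral_sub_le_of_residual ?_ (fun x => ?_) hρ hp ?_ htransfer
    fun x hx => residual_deriv_le hx
  · exact (Real.measurable_log.comp (by fun_prop)).indicator measurableSet_Icc
  · by_cases hx : x ∈ Icc (0 : ℝ) 1
    · rw [indicator_of_mem hx]
      exact abs_log_five_halves_sub_le_one hx
    · simp [indicator_of_notMem hx]
  · rw [← intervalIntegral_zero_one_eq, ← intervalIntegral_zero_one_eq, hint,
      integral_polyDensity]

end LanfordTransfer

/-- If `ρ` is a nonnegative function of bounded variation on `[0,1]` with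
`∫₀¹ ρ = 1` satisfying the transfer (Perron--Frobenius) equation of the Lanford map for
Lebesgue-a.e. `x ∈ [0,1)`, then the Lyapunov exponent `∫₀¹ log(5/2 - x) ρ(x) dx` agrees
with the stated 128-digit value to within `2 × 10⁻¹²⁸`. -/
theorem lanford_lyapunov_exponent
    (ρ : ℝ → ℝ)
    (hpos : ∀ x ∈ Set.Icc (0 : ℝ) 1, 0 ≤ ρ x)
    (hbv : BoundedVariationOn ρ (Set.Icc 0 1))
    (hint : (∫ x in (0 : ℝ)..1, ρ x) = 1)
    (htransfer : ∀ᵐ x ∂(MeasureTheory.volume.restrict (Set.Ico (0 : ℝ) 1)),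
      ρ x = ∑' y : {y : ℝ // y ∈ Set.Ico (0 : ℝ) 1 ∧ lanford y = x},
        ρ (y : ℝ) / (5 / 2 - (y : ℝ))) :
    |(∫ x in (0 : ℝ)..1, Real.log (5 / 2 - x) * ρ x) -
        0.65766178000659767754158241382383206574324106958001220195395280269163266611155402375955645975291517482964215633179802630148859489| ≤
      2 / 10 ^ 128 := by
  have htransfer' : ∀ᵐ x ∂MeasureTheory.volume.restrict (Set.Ico (0 : ℝ) 1),
      ρ x = transferOp ρ x := by
    filter_upwards [htransfer, MeasureTheory.ae_restrict_mem measurableSet_Ico] with x h hx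
    rw [h, tsum_preimage_lanford ρ hx]
  refine (abs_sub_le _ _ _).trans ((add_le_add (abs_lyapunov_sub_le hint htransfer')
    abs_integral_log_mul_polyDensity_sub_le).trans ?_)
  norm_num
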